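/- arXiv:2402.13354 — 4 statements merged into one kernel-verified Lean document; each statement's English description precedes it below -/
import Mathlib

section
/- With P = k[x,y,z,w], Φ a degree-3 Macaulay inverse system, ann Φ containing no nonzero linear form, and p bijective, the following holds for all k-linear functionals ν, ν' : P_1 → k with ν(x) = ν'(x) = 0. Define the linear form c := (ν(z)ν'(w)−ν(w)ν'(z))·y + (ν(w)ν'(y)−ν(y)ν'(w))·z + (ν(y)ν'(z)−ν(z)ν'(y))·w, and for a functional μ with μ(x) = 0 define the linear form γ(μ) := (SM₁₁μ(y)+SM₁₂μ(z)+SM₁₃μ(w))·y + (SM₂₁μ(y)+SM₂₂μ(z)+SM₂₃μ(w))·z + (SM₃₁μ(y)+SM₃₂μ(z)+SM₃₃μ(w))·w. Then ν'(ℓ_{c·γ(ν)}) = ν(ℓ_{c·γ(ν')}). (This is the symmetry identity expressing that the second differential of the resolution of P/ann Φ restricts to an alternating map.) -/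
open MvPolynomial

noncomputable section

variable (k : Type*) [Field k]

/-- The annihilator ideal `ann Φ = {f : Φ(f·g) = 0 for all g}` of the
linear functional `Φ`. -/
def annIdeal (Φ : MvPolynomial (Fin 4) k →ₗ[k] k) : Ideal (MvPolynomial (Fin 4) k) where
  carrier := {f | ∀ g, Φ (f * g) = 0}
  add_mem' := by
    intro a b ha hb g
    rw [add_mul, map_add, ha g, hb g, add_zero]
  zero_mem' := by intro g; simp
  smul_mem' := by
    intro c a ha g
    have h : c • a * g = a * (c * g) := by rw [smul_eq_mul]; ring
    rw [h]; exact ha (c * g)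

/-- The Macaulay map `p : P₁ → Hom(P₁, k)`, `p(u)(v) = Φ(x·u·v)`. -/
def pMap (Φ : MvPolynomial (Fin 4) k →ₗ[k] k) :
    homogeneousSubmodule (Fin 4) k 1 →ₗ[k]
      (homogeneousSubmodule (Fin 4) k 1 →ₗ[k] k) where
  toFun u :=
    { toFun := fun v => Φ (X 0 * u.1 * v.1)
      map_add' := fun v w => by simp [mul_add]
      map_smul' := fun c v => by simp [mul_smul_comm] }
  map_add' u u' := by
    ext v
    simp [add_mul, mul_add]
  map_smul' c u := by
    ext v
    simp [mul_smul_comm, smul_mul_assoc]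

/-- The symmetric `3 × 3` matrix `SM` of (6.3), built from the Macaulay inverse
system `Φ` and the linear forms `ℓ_q` (`p⁻¹(q·Φ)` for the quadrics `q`);
here `⟨q,q'⟩ = Φ(q·ℓ_{q'})`. -/
def smMatrix (Φ : MvPolynomial (Fin 4) k →ₗ[k] k)
    (ly2 lyz lyw lz2 lzw lw2 : MvPolynomial (Fin 4) k) : Matrix (Fin 3) (Fin 3) k :=
  !![Φ (X 2 ^ 2 * lw2) - Φ (X 2 * X 3 * lzw),
      Φ (X 2 * X 3 * lyw) - Φ (X 2 * X 1 * lw2),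
      Φ (X 1 * X 2 * lzw) - Φ (X 2 ^ 2 * lyw);
    Φ (X 1 * X 3 * lzw) - Φ (X 1 * X 2 * lw2),
      Φ (X 1 ^ 2 * lw2) - Φ (X 1 * X 3 * lyw),
      Φ (X 1 * X 2 * lyw) - Φ (X 1 ^ 2 * lzw);
    Φ (X 1 * X 2 * lzw) - Φ (X 1 * X 3 * lz2),
      Φ (X 1 * X 3 * lyz) - Φ (X 1 ^ 2 * lzw),
      Φ (X 1 ^ 2 * lz2) - Φ (X 1 * X 2 * lyz)]

/-- The variable `Xᵢ` as an element of `P₁`. -/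
def varP1 (i : Fin 4) : homogeneousSubmodule (Fin 4) k 1 :=
  ⟨X i, (mem_homogeneousSubmodule _ _).2 (isHomogeneous_X k i)⟩

/-- The linear form
`c = (ν(z)ν'(w)−ν(w)ν'(z))·y + (ν(w)ν'(y)−ν(y)ν'(w))·z + (ν(y)ν'(z)−ν(z)ν'(y))·w`,
written in terms of the values `a = ν(y), b = ν(z), c = ν(w)` and
`a' = ν'(y), b' = ν'(z), c' = ν'(w)`. -/
def crossForm (a b c a' b' c' : k) : MvPolynomial (Fin 4) k :=
  C (b * c' - c * b') * X 1 + C (c * a' - a * c') * X 2 + C (a * b' - b * a') * X 3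

/-- The linear form `γ(μ)` obtained by applying the matrix `S` to the vector of
values `(a, b, c) = (μ(y), μ(z), μ(w))`. -/
def gammaForm (S : Matrix (Fin 3) (Fin 3) k) (a b c : k) : MvPolynomial (Fin 4) k :=
  C (S 0 0 * a + S 0 1 * b + S 0 2 * c) * X 1 +
    C (S 1 0 * a + S 1 1 * b + S 1 2 * c) * X 2 +
    C (S 2 0 * a + S 2 1 * b + S 2 2 * c) * X 3

set_option linter.unusedSimpArgs false in
theorem core_identity {k : Type*} [Field k] (m : Fin 3 → Fin 3 → Fin 3 → k)
    (B : Fin 3 → Fin 3 → Fin 3 → Fin 3 → k) (f : Fin 3 → Fin 3 → Fin 3 → k)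
    (al : Fin 3 → Fin 3 → k) (n n' : Fin 3 → k)
    (hm : ∀ l i j, m l i j = m l j i) (ha : ∀ i j, al i j = al j i)
    (hB1 : ∀ i j p q, B i j p q = B j i p q) (hB2 : ∀ i j p q, B i j p q = B i j q p)
    (hB : ∀ i j p q, B i j p q = B p q i j)
    (hf1 : ∀ i j p, f i j p = f j i p) (hf2 : ∀ i j p, f i j p = f i p j)
    (hA : ∀ r i j p q, al i j * f r p q + (m 0 i j * B 0 r p q + m 1 i j * B 1 r p q +
      m 2 i j * B 2 r p q) = al p q * f r i j + (m 0 p q * B 0 r i j + m 1 p q * B 1 r i j +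
      m 2 p q * B 2 r i j))
    (S : Matrix (Fin 3) (Fin 3) k)
    (hS : S = !![B 1 1 2 2 - B 1 2 1 2, B 1 2 0 2 - B 1 0 2 2, B 0 1 1 2 - B 1 1 0 2;
      B 0 2 1 2 - B 0 1 2 2, B 0 0 2 2 - B 0 2 0 2, B 0 1 0 2 - B 0 0 1 2;
      B 0 1 1 2 - B 0 2 1 1, B 0 2 0 1 - B 0 0 1 2, B 0 0 1 1 - B 0 1 0 1])
    (c : Fin 3 → k) (hc : c = ![n 1 * n' 2 - n 2 * n' 1, n 2 * n' 0 - n 0 * n' 2,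
      n 0 * n' 1 - n 1 * n' 0]) :
    ∑ i, ∑ j, c i * (S j 0 * n 0 + S j 1 * n 1 + S j 2 * n 2) * (∑ l, m l i j * n' l) =
    ∑ i, ∑ j, c i * (S j 0 * n' 0 + S j 1 * n' 1 + S j 2 * n' 2) * (∑ l, m l i j * n l) := by
  have m10 : ∀ l, m l 1 0 = m l 0 1 := fun l => hm l _ _
  have l10 : ∀ p q, B 1 0 p q = B 0 1 p q := fun p q => hB1 _ _ _ _
  have r10 : ∀ p q, B p q 1 0 = B p q 0 1 := fun p q => hB2 _ _ _ _
  have f10 : ∀ p, f p 1 0 = f p 0 1 := fun p => hf2 _ _ _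
  have g10 : ∀ p, f 1 0 p = f 0 1 p := fun p => hf1 _ _ _
  have a10 : al 1 0 = al 0 1 := ha _ _
  have m20 : ∀ l, m l 2 0 = m l 0 2 := fun l => hm l _ _
  have l20 : ∀ p q, B 2 0 p q = B 0 2 p q := fun p q => hB1 _ _ _ _
  have r20 : ∀ p q, B p q 2 0 = B p q 0 2 := fun p q => hB2 _ _ _ _
  have f20 : ∀ p, f p 2 0 = f p 0 2 := fun p => hf2 _ _ _
  have g20 : ∀ p, f 2 0 p = f 0 2 p := fun p => hf1 _ _ _
  have a20 : al 2 0 = al 0 2 := ha _ _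
  have m21 : ∀ l, m l 2 1 = m l 1 2 := fun l => hm l _ _
  have l21 : ∀ p q, B 2 1 p q = B 1 2 p q := fun p q => hB1 _ _ _ _
  have r21 : ∀ p q, B p q 2 1 = B p q 1 2 := fun p q => hB2 _ _ _ _
  have f21 : ∀ p, f p 2 1 = f p 1 2 := fun p => hf2 _ _ _
  have g21 : ∀ p, f 2 1 p = f 1 2 p := fun p => hf1 _ _ _
  have a21 : al 2 1 = al 1 2 := ha _ _
  have s0100 : B 0 1 0 0 = B 0 0 0 1 := hB _ _ _ _
  have s0200 : B 0 2 0 0 = B 0 0 0 2 := hB _ _ _ _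
  have s0201 : B 0 2 0 1 = B 0 1 0 2 := hB _ _ _ _
  have s1100 : B 1 1 0 0 = B 0 0 1 1 := hB _ _ _ _
  have s1101 : B 1 1 0 1 = B 0 1 1 1 := hB _ _ _ _
  have s1102 : B 1 1 0 2 = B 0 2 1 1 := hB _ _ _ _
  have s1200 : B 1 2 0 0 = B 0 0 1 2 := hB _ _ _ _
  have s1201 : B 1 2 0 1 = B 0 1 1 2 := hB _ _ _ _
  have s1202 : B 1 2 0 2 = B 0 2 1 2 := hB _ _ _ _
  have s1211 : B 1 2 1 1 = B 1 1 1 2 := hB _ _ _ _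
  have s2200 : B 2 2 0 0 = B 0 0 2 2 := hB _ _ _ _
  have s2201 : B 2 2 0 1 = B 0 1 2 2 := hB _ _ _ _
  have s2202 : B 2 2 0 2 = B 0 2 2 2 := hB _ _ _ _
  have s2211 : B 2 2 1 1 = B 1 1 2 2 := hB _ _ _ _
  have s2212 : B 2 2 1 2 = B 1 2 2 2 := hB _ _ _ _
  have A10002 := hA 1 0 0 0 2
  have A20001 := hA 2 0 0 0 1
  have A00102 := hA 0 0 1 0 2
  have A10012 := hA 1 0 0 1 2
  have A20011 := hA 2 0 0 1 1
  have A00211 := hA 0 0 2 1 1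
  have A10102 := hA 1 0 1 0 2
  have A00112 := hA 0 0 1 1 2
  have A21110 := hA 2 1 1 1 0
  have A01112 := hA 0 1 1 1 2
  have A11210 := hA 1 1 2 1 0
  have A21120 := hA 2 1 1 2 0
  have A01122 := hA 0 1 1 2 2
  have A11022 := hA 1 1 0 2 2
  have A21210 := hA 2 1 2 1 0
  have A11220 := hA 1 1 2 2 0
  have A02221 := hA 0 2 2 2 1
  have A12220 := hA 1 2 2 2 0
  have A22021 := hA 2 2 0 2 1
  have A02201 := hA 0 2 2 0 1
  have A12200 := hA 1 2 2 0 0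
  have A22100 := hA 2 2 1 0 0
  have A02021 := hA 0 2 0 2 1
  have A22001 := hA 2 2 0 0 1
  subst hS hc
  simp only [m10, l10, r10, f10, g10, a10, m20, l20, r20, f20, g20, a20, m21, l21, r21, f21, g21, a21, s0100, s0200, s0201, s1100, s1101, s1102, s1200, s1201, s1202, s1211, s2200, s2201, s2202, s2211, s2212] at A10002 A20001 A00102 A10012 A20011 A00211 A10102 A00112 A21110 A01112 A11210 A21120 A01122 A11022 A21210 A11220 A02221 A12220 A22021 A02201 A12200 A22100 A02021 A22001
  simp only [Fin.sum_univ_three, Matrix.of_apply, Matrix.cons_val', Matrix.cons_val_zero,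
    Matrix.cons_val_one, Matrix.cons_val, m10, l10, r10, f10, g10, a10, m20, l20, r20, f20, g20, a20, m21, l21, r21, f21, g21, a21, s0100, s0200, s0201, s1100, s1101, s1102, s1200, s1201, s1202, s1211, s2200, s2201, s2202, s2211, s2212]
  linear_combination (n 1 * n' 2 - n 2 * n' 1)^2*(A10002-A20001-A00102) + (n 1 * n' 2 - n 2 * n' 1)*(n 2 * n' 0 - n 0 * n' 2)*(A10012-A20011+A00211+A10102-A00112) + (n 2 * n' 0 - n 0 * n' 2)^2*(A21110-A01112-A11210) + (n 2 * n' 0 - n 0 * n' 2)*(n 0 * n' 1 - n 1 * n' 0)*(A21120-A01122+A11022+A21210-A11220) + (n 0 * n' 1 - n 1 * n' 0)^2*(A02221-A12220-A22021) + (n 0 * n' 1 - n 1 * n' 0)*(n 1 * n' 2 - n 2 * n' 1)*(A02201-A12200+A22100+A02021-A22001)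

theorem lin_decomp {k : Type*} [Field k] (u : MvPolynomial (Fin 4) k)
    (hu : u ∈ homogeneousSubmodule (Fin 4) k 1) :
    ∃ a : Fin 4 → k, u = a 0 • X 0 + (a 1 • X 1 + a 2 • X 2 + a 3 • X 3) := by
  rw [homogeneousSubmodule_one_eq_span_X, Submodule.mem_span_range_iff_exists_fun] at hu
  obtain ⟨a, h⟩ := hu
  refine ⟨a, ?_⟩
  rw [← h, Fin.sum_univ_four]
  ring

theorem eval_lin {k : Type*} [Field k] (ν : homogeneousSubmodule (Fin 4) k 1 →ₗ[k] k)
    (hν : ν (varP1 k 0) = 0) (u : MvPolynomial (Fin 4) k)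
    (hu : u ∈ homogeneousSubmodule (Fin 4) k 1) (a : Fin 4 → k)
    (h : u = a 0 • X 0 + (a 1 • X 1 + a 2 • X 2 + a 3 • X 3)) :
    ν ⟨u, hu⟩ = a 1 * ν (varP1 k 1) + a 2 * ν (varP1 k 2) + a 3 * ν (varP1 k 3) := by
  have : (⟨u, hu⟩ : homogeneousSubmodule (Fin 4) k 1) =
      a 0 • varP1 k 0 + (a 1 • varP1 k 1 + a 2 • varP1 k 2 + a 3 • varP1 k 3) := by
    apply Subtype.ext
    simpa [varP1] using h
  rw [this]
  simp [hν]

theorem eval_L {k : Type*} [Field k] (Φ : MvPolynomial (Fin 4) k →ₗ[k] k)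
    (hp : Function.Bijective (pMap k Φ))
    (el : Fin 3 → Fin 3 → MvPolynomial (Fin 4) k)
    (helm : ∀ i j, el i j ∈ homogeneousSubmodule (Fin 4) k 1)
    (hel : ∀ i j, ∀ v ∈ homogeneousSubmodule (Fin 4) k 1,
      Φ (X 0 * el i j * v) = Φ (X i.succ * X j.succ * v))
    (a : Fin 3 → Fin 3 → Fin 4 → k)
    (ha : ∀ i j, el i j = a i j 0 • X 0 + (a i j 1 • X 1 + a i j 2 • X 2 + a i j 3 • X 3))
    (ν : homogeneousSubmodule (Fin 4) k 1 →ₗ[k] k) (hν : ν (varP1 k 0) = 0)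
    (c g : Fin 3 → k) (L : MvPolynomial (Fin 4) k)
    (hLm : L ∈ homogeneousSubmodule (Fin 4) k 1)
    (hL : ∀ v ∈ homogeneousSubmodule (Fin 4) k 1,
      Φ (X 0 * L * v) = Φ ((C (c 0) * X 1 + C (c 1) * X 2 + C (c 2) * X 3) *
        (C (g 0) * X 1 + C (g 1) * X 2 + C (g 2) * X 3) * v)) :
    ν ⟨L, hLm⟩ = ∑ i, ∑ j, c i * g j * (∑ l : Fin 3, a i j l.succ * ν (varP1 k l.succ)) := by
  have key : (⟨L, hLm⟩ : homogeneousSubmodule (Fin 4) k 1) =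
      ∑ i, ∑ j, (c i * g j) • (⟨el i j, helm i j⟩ : homogeneousSubmodule (Fin 4) k 1) := by
    apply hp.1
    ext v
    have e1 : ∀ i j, pMap k Φ ⟨el i j, helm i j⟩ v = Φ (X i.succ * X j.succ * v.1) :=
      fun i j => hel i j v.1 v.2
    have e2 : pMap k Φ ⟨L, hLm⟩ v = _ := hL v.1 v.2
    simp only [map_sum, map_smul, LinearMap.sum_apply, LinearMap.smul_apply, e1]
    rw [e2]
    simp only [← map_smul, ← map_sum]
    congr 1
    simp only [Fin.sum_univ_three, smul_eq_C_mul, map_mul]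
    simp only [show (0 : Fin 3).succ = 1 from rfl, show (1 : Fin 3).succ = 2 from rfl,
      show (2 : Fin 3).succ = 3 from rfl]
    ring
  rw [key]
  simp only [map_sum, map_smul, smul_eq_mul]
  refine Finset.sum_congr rfl fun i _ => Finset.sum_congr rfl fun j _ => ?_
  rw [eval_lin ν hν _ (helm i j) (a i j) (ha i j), Fin.sum_univ_three]
  rfl


/-- **Lemma 13.7.**  Assume `Φ` is a degree-3 Macaulay inverse system on
`P = k[x,y,z,w]` whose annihilator contains no nonzero linear form and `p` is
bijective.  For all functionals `ν, ν'` on `P₁` vanishing at `x`, with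
`c` the cross linear form and `γ` as above, one has
`ν'(ℓ_{c·γ(ν)}) = ν(ℓ_{c·γ(ν')})`; i.e. the map `𝔏` is alternating. -/
theorem alternating_identity
    (Φ : MvPolynomial (Fin 4) k →ₗ[k] k)
    (hΦ : ∀ m : Fin 4 →₀ ℕ, (m.sum fun _ e => e) ≠ 3 → Φ (monomial m 1) = 0)
    (hlin : ∀ u ∈ homogeneousSubmodule (Fin 4) k 1, u ∈ annIdeal k Φ → u = 0)
    (hp : Function.Bijective (pMap k Φ))
    (ly2 lyz lyw lz2 lzw lw2 : MvPolynomial (Fin 4) k)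
    (hly2m : ly2 ∈ homogeneousSubmodule (Fin 4) k 1)
    (hlyzm : lyz ∈ homogeneousSubmodule (Fin 4) k 1)
    (hlywm : lyw ∈ homogeneousSubmodule (Fin 4) k 1)
    (hlz2m : lz2 ∈ homogeneousSubmodule (Fin 4) k 1)
    (hlzwm : lzw ∈ homogeneousSubmodule (Fin 4) k 1)
    (hlw2m : lw2 ∈ homogeneousSubmodule (Fin 4) k 1)
    (hly2 : ∀ v ∈ homogeneousSubmodule (Fin 4) k 1,
      Φ (X 0 * ly2 * v) = Φ (X 1 ^ 2 * v))
    (hlyz : ∀ v ∈ homogeneousSubmodule (Fin 4) k 1,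
      Φ (X 0 * lyz * v) = Φ (X 1 * X 2 * v))
    (hlyw : ∀ v ∈ homogeneousSubmodule (Fin 4) k 1,
      Φ (X 0 * lyw * v) = Φ (X 1 * X 3 * v))
    (hlz2 : ∀ v ∈ homogeneousSubmodule (Fin 4) k 1,
      Φ (X 0 * lz2 * v) = Φ (X 2 ^ 2 * v))
    (hlzw : ∀ v ∈ homogeneousSubmodule (Fin 4) k 1,
      Φ (X 0 * lzw * v) = Φ (X 2 * X 3 * v))
    (hlw2 : ∀ v ∈ homogeneousSubmodule (Fin 4) k 1,
      Φ (X 0 * lw2 * v) = Φ (X 3 ^ 2 * v))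
    (ν ν' : homogeneousSubmodule (Fin 4) k 1 →ₗ[k] k)
    (hν : ν (varP1 k 0) = 0) (hν' : ν' (varP1 k 0) = 0)
    (L1 L2 : MvPolynomial (Fin 4) k)
    (hL1m : L1 ∈ homogeneousSubmodule (Fin 4) k 1)
    (hL2m : L2 ∈ homogeneousSubmodule (Fin 4) k 1)
    (hL1 : ∀ v ∈ homogeneousSubmodule (Fin 4) k 1,
      Φ (X 0 * L1 * v) =
        Φ (crossForm k (ν (varP1 k 1)) (ν (varP1 k 2)) (ν (varP1 k 3))
              (ν' (varP1 k 1)) (ν' (varP1 k 2)) (ν' (varP1 k 3)) *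
            gammaForm k (smMatrix k Φ ly2 lyz lyw lz2 lzw lw2)
              (ν (varP1 k 1)) (ν (varP1 k 2)) (ν (varP1 k 3)) * v))
    (hL2 : ∀ v ∈ homogeneousSubmodule (Fin 4) k 1,
      Φ (X 0 * L2 * v) =
        Φ (crossForm k (ν (varP1 k 1)) (ν (varP1 k 2)) (ν (varP1 k 3))
              (ν' (varP1 k 1)) (ν' (varP1 k 2)) (ν' (varP1 k 3)) *
            gammaForm k (smMatrix k Φ ly2 lyz lyw lz2 lzw lw2)
              (ν' (varP1 k 1)) (ν' (varP1 k 2)) (ν' (varP1 k 3)) * v)) :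
    ν' ⟨L1, hL1m⟩ = ν ⟨L2, hL2m⟩ := by
  obtain ⟨el, hel_def⟩ : ∃ el : Fin 3 → Fin 3 → MvPolynomial (Fin 4) k,
    el = ![![ly2, lyz, lyw], ![lyz, lz2, lzw], ![lyw, lzw, lw2]] := ⟨_, rfl⟩
  have e00 : el 0 0 = ly2 := by rw [hel_def]; rfl
  have e01 : el 0 1 = lyz := by rw [hel_def]; rfl
  have e02 : el 0 2 = lyw := by rw [hel_def]; rfl
  have e11 : el 1 1 = lz2 := by rw [hel_def]; rfl
  have e12 : el 1 2 = lzw := by rw [hel_def]; rfl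
  have e22 : el 2 2 = lw2 := by rw [hel_def]; rfl
  have s01 : (0 : Fin 3).succ = 1 := rfl
  have s12 : (1 : Fin 3).succ = 2 := rfl
  have s23 : (2 : Fin 3).succ = 3 := rfl
  have esym : ∀ i j, el i j = el j i := by
    intro i j; rw [hel_def]; fin_cases i <;> fin_cases j <;> rfl
  have eall : ∀ Q : Fin 3 → Fin 3 → Prop, (∀ i j, Q i j → Q j i) → Q 0 0 → Q 0 1 → Q 0 2 →
      Q 1 1 → Q 1 2 → Q 2 2 → ∀ i j, Q i j := by
    intro Q hs h00 h01 h02 h11 h12 h22 i j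
    fin_cases i <;> fin_cases j <;> first | assumption | (apply hs; assumption)
  have helm : ∀ i j, el i j ∈ homogeneousSubmodule (Fin 4) k 1 := by
    apply eall
    · intro i j h; rw [esym]; exact h
    all_goals simp only [e00, e01, e02, e11, e12, e22]; assumption
  have hel : ∀ i j, ∀ v ∈ homogeneousSubmodule (Fin 4) k 1,
      Φ (X 0 * el i j * v) = Φ (X i.succ * X j.succ * v) := by
    apply eall
    · intro i j h v hv; rw [esym, h v hv, mul_comm (X i.succ)]
    all_goals simp only [e00, e01, e02, e11, e12, e22, s01, s12, s23, ← pow_two]; assumption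
  have hX : ∀ i, (X i : MvPolynomial (Fin 4) k) ∈ homogeneousSubmodule (Fin 4) k 1 :=
    fun i => (varP1 k i).2
  choose a0 ha0 using fun i j => lin_decomp (el i j) (helm i j)
  obtain ⟨a, ha, hasym⟩ : ∃ a : Fin 3 → Fin 3 → Fin 4 → k,
      (∀ i j, el i j = a i j 0 • X 0 + (a i j 1 • X 1 + a i j 2 • X 2 + a i j 3 • X 3)) ∧
      ∀ i j, a i j = a j i := by
    refine ⟨fun i j => a0 (min i j) (max i j), fun i j => ?_, fun i j => ?_⟩
    · rcases le_total i j with h | h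
      · simp only [min_eq_left h, max_eq_right h]; exact ha0 i j
      · simp only [min_eq_right h, max_eq_left h]; rw [esym]; exact ha0 j i
    · simp only [min_comm i j, max_comm i j]
  have hexp : ∀ r i j p q : Fin 3, Φ (X r.succ * el i j * el p q) =
      a i j 0 * Φ (X r.succ * X p.succ * X q.succ) +
      (a i j 1 * Φ (X (0 : Fin 3).succ * X r.succ * el p q) +
       a i j 2 * Φ (X (1 : Fin 3).succ * X r.succ * el p q) +
       a i j 3 * Φ (X (2 : Fin 3).succ * X r.succ * el p q)) := by
    intro r i j p q
    have h1 : Φ (X r.succ * X p.succ * X q.succ) = Φ (X 0 * el p q * X r.succ) := by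
      rw [hel p q _ (hX _)]; congr 1; ring
    rw [h1, ha i j]
    simp only [← smul_eq_mul, ← map_smul, ← map_add, s01, s12, s23]
    congr 1
    simp only [smul_eq_C_mul]
    ring
  generalize hS : smMatrix k Φ ly2 lyz lyw lz2 lzw lw2 = S at hL1 hL2
  obtain ⟨c, hc⟩ : ∃ c : Fin 3 → k, c = ![ν (varP1 k 2) * ν' (varP1 k 3) -
      ν (varP1 k 3) * ν' (varP1 k 2), ν (varP1 k 3) * ν' (varP1 k 1) -
      ν (varP1 k 1) * ν' (varP1 k 3), ν (varP1 k 1) * ν' (varP1 k 2) -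
      ν (varP1 k 2) * ν' (varP1 k 1)] := ⟨_, rfl⟩
  rw [eval_L Φ hp el helm hel a ha ν' hν' c
      (fun i => S i 0 * ν (varP1 k 1) + S i 1 * ν (varP1 k 2) + S i 2 * ν (varP1 k 3)) L1 hL1m
      (by rw [hc]; exact hL1),
    eval_L Φ hp el helm hel a ha ν hν c
      (fun i => S i 0 * ν' (varP1 k 1) + S i 1 * ν' (varP1 k 2) + S i 2 * ν' (varP1 k 3)) L2 hL2m
      (by rw [hc]; exact hL2)]
  refine core_identity (fun l i j => a i j l.succ)
    (fun i j p q => Φ (X i.succ * X j.succ * el p q))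
    (fun i j p => Φ (X i.succ * X j.succ * X p.succ)) (fun i j => a i j 0)
    (fun i => ν (varP1 k i.succ)) (fun i => ν' (varP1 k i.succ))
    ?_ ?_ ?_ ?_ ?_ ?_ ?_ ?_ S ?_ c hc
  · intro l i j; simp only [hasym i j]
  · intro i j; simp only [hasym i j]
  · intro i j p q; simp only [mul_comm (X i.succ)]
  · intro i j p q; simp only [esym p q]
  · intro i j p q
    rw [← hel i j _ (helm p q), ← hel p q _ (helm i j)]
    congr 1; ring
  · intro i j p; simp only [mul_comm (X i.succ)]
  · intro i j p; congr 1; ring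
  · intro r i j p q
    have h1 := hexp r i j p q
    have h2 := hexp r p q i j
    have h3 : Φ (X r.succ * el i j * el p q) = Φ (X r.succ * el p q * el i j) := by
      congr 1; ring
    exact h1.symm.trans (h3.trans h2)
  · rw [← hS]
    simp only [e00, e01, e02, e11, e12, e22, s01, s12, s23, ← pow_two]
    rfl

end
end

section
/- Let R₀ be a commutative ring and R = R₀[x] the polynomial ring in one variable. Let M be an R-module equipped with a family (M_n)_{n ∈ ℕ} of R₀-submodules whose internal direct sum (as an R₀-module) is all of M, and such that x·M_n ⊆ M_{n+1} for every n. If the multiplication map M → M, m ↦ x·m, is surjective, then M = 0. (This is the graded vanishing principle proved inside Lemma 9.3 of the paper, which deduces vanishing of homology of a homogeneous complex of free modules from vanishing of the homology of its reduction modulo x.) -/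
/-- The graded vanishing principle inside **Lemma 9.3**.  Let `R₀` be a
commutative ring, `R = R₀[x]`, and `M` an `R`-module equipped with a family of
`R₀`-submodules `(M_n)` whose internal direct sum is all of `M` and with
`x·M_n ⊆ M_{n+1}`.  If multiplication by `x` on `M` is surjective, then
`M = 0`. -/
theorem eq_zero_of_surjective_smul_X
    (R₀ : Type*) [CommRing R₀] (M : Type*) [AddCommGroup M]
    [Module R₀ M] [Module (Polynomial R₀) M] [IsScalarTower R₀ (Polynomial R₀) M]
    (Mn : ℕ → Submodule R₀ M)
    (hinternal : DirectSum.IsInternal Mn)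
    (hx : ∀ n : ℕ, ∀ m ∈ Mn n, (Polynomial.X : Polynomial R₀) • m ∈ Mn (n + 1))
    (hsurj : Function.Surjective fun m : M => (Polynomial.X : Polynomial R₀) • m) :
    ∀ m : M, m = 0 := by
  have key : ∀ n : ℕ, ∀ m : M, m ∈ ⨆ k, Mn (n + k) := by
    intro n
    induction n with
    | zero =>
      intro m
      simp only [Nat.zero_add]
      rw [hinternal.submodule_iSup_eq_top]
      trivial
    | succ n ih =>
      intro m
      obtain ⟨m', rfl⟩ := hsurj m
      refine Submodule.iSup_induction (fun k => Mn (n + k))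
        (motive := fun m' => (Polynomial.X : Polynomial R₀) • m' ∈ ⨆ k, Mn (n + 1 + k))
        (ih m') ?_ ?_ ?_
      · intro k y hy
        refine Submodule.mem_iSup_of_mem k ?_
        have h := hx _ y hy
        rwa [show n + k + 1 = n + 1 + k by omega] at h
      · rw [smul_zero]
        exact Submodule.zero_mem _
      · intro y z hy hz
        rw [smul_add]
        exact Submodule.add_mem _ hy hz
  have hz : ∀ n, ∀ m ∈ Mn n, m = 0 := by
    intro n m hm
    have hle : (⨆ k, Mn (n + 1 + k)) ≤ ⨆ j, ⨆ (_ : j ≠ n), Mn j :=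
      iSup_le fun k => le_iSup₂_of_le (n + 1 + k) (by omega) le_rfl
    exact Submodule.disjoint_def.1 (hinternal.submodule_iSupIndep n) m hm
      (hle (key (n + 1) m))
  intro m
  refine Submodule.iSup_induction (fun k => Mn (0 + k)) (motive := fun m => m = 0)
    (key 0 m) (fun k y hy => hz _ y hy) rfl ?_
  rintro y z rfl rfl
  exact add_zero 0
end

section
/- With P = k[x,y,z,w], Φ a degree-3 Macaulay inverse system, ann Φ containing no nonzero linear form, p bijective, and SM = diag(α,0,0) with α ≠ 0, define: π₁ := (c_y(ℓ_{y²}) − c_w(ℓ_{yw}))·x − y, π₂ := c_y(ℓ_{yz})·x − z, π₃ := c_y(ℓ_{yw})·x − w, w₁ := c_w(ℓ_{yw})·x − y, u₁₁ := −c_y(ℓ_{w²})·x, u₁₂ := −c_z(ℓ_{w²})·x, u₁₃ := (c_y(ℓ_{yw}) − c_w(ℓ_{w²}))·x + w, u₂₁ := −c_y(ℓ_{zw})·x, u₂₂ := −c_z(ℓ_{zw})·x + w, u₂₃ := (c_y(ℓ_{yz}) − c_w(ℓ_{zw}))·x. Then the following five polynomial identities hold in P: y² − x·ℓ_{y²}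 = w₁·π₁; yz − x·ℓ_{yz} = w₁·π₂; yw − x·ℓ_{yw} = w₁·π₃; zw − x·ℓ_{zw} = −(u₂₁π₁ + u₂₂π₂ + u₂₃π₃); and w² − x·ℓ_{w²} = −(u₁₁π₁ + u₁₂π₂ + u₁₃π₃). -/
open MvPolynomial

noncomputable section

variable (k : Type*) [Field k]

/-- The coefficient of the variable `Xᵢ` in a polynomial. -/
def varCoeff (i : Fin 4) (u : MvPolynomial (Fin 4) k) : k :=
  MvPolynomial.coeff (Finsupp.single i 1) u

/-- `π₁ = (c_y(ℓ_{y²}) − c_w(ℓ_{yw}))·x − y`. -/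
def pi1 (ly2 lyw : MvPolynomial (Fin 4) k) : MvPolynomial (Fin 4) k :=
  C (varCoeff k 1 ly2 - varCoeff k 3 lyw) * X 0 - X 1

/-- `π₂ = c_y(ℓ_{yz})·x − z`. -/
def pi2 (lyz : MvPolynomial (Fin 4) k) : MvPolynomial (Fin 4) k :=
  C (varCoeff k 1 lyz) * X 0 - X 2

/-- `π₃ = c_y(ℓ_{yw})·x − w`. -/
def pi3 (lyw : MvPolynomial (Fin 4) k) : MvPolynomial (Fin 4) k :=
  C (varCoeff k 1 lyw) * X 0 - X 3

/-- `w₁ = c_w(ℓ_{yw})·x − y`. -/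
def w1 (lyw : MvPolynomial (Fin 4) k) : MvPolynomial (Fin 4) k :=
  C (varCoeff k 3 lyw) * X 0 - X 1

/-- `u₁₁ = −c_y(ℓ_{w²})·x`. -/
def u11 (lw2 : MvPolynomial (Fin 4) k) : MvPolynomial (Fin 4) k :=
  -(C (varCoeff k 1 lw2) * X 0)

/-- `u₁₂ = −c_z(ℓ_{w²})·x`. -/
def u12 (lw2 : MvPolynomial (Fin 4) k) : MvPolynomial (Fin 4) k :=
  -(C (varCoeff k 2 lw2) * X 0)

/-- `u₁₃ = (c_y(ℓ_{yw}) − c_w(ℓ_{w²}))·x + w`. -/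
def u13 (lyw lw2 : MvPolynomial (Fin 4) k) : MvPolynomial (Fin 4) k :=
  C (varCoeff k 1 lyw - varCoeff k 3 lw2) * X 0 + X 3

/-- `u₂₁ = −c_y(ℓ_{zw})·x`. -/
def u21 (lzw : MvPolynomial (Fin 4) k) : MvPolynomial (Fin 4) k :=
  -(C (varCoeff k 1 lzw) * X 0)

/-- `u₂₂ = −c_z(ℓ_{zw})·x + w`. -/
def u22 (lzw : MvPolynomial (Fin 4) k) : MvPolynomial (Fin 4) k :=
  -(C (varCoeff k 2 lzw) * X 0) + X 3

/-- `u₂₃ = (c_y(ℓ_{yz}) − c_w(ℓ_{zw}))·x`. -/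
def u23 (lyz lzw : MvPolynomial (Fin 4) k) : MvPolynomial (Fin 4) k :=
  C (varCoeff k 1 lyz - varCoeff k 3 lzw) * X 0


theorem brown_core {k V : Type*} [Field k] [AddCommGroup V] [Module k V]
    (m : V →ₗ[k] V →ₗ[k] V) (b : V →ₗ[k] V →ₗ[k] k) (x y z w : V)
    (hspan : ∀ u : V, ∃ c0 c1 c2 c3 : k, u = c0 • x + c1 • y + c2 • z + c3 • w)
    (hind : ∀ c0 c1 c2 c3 : k, c0 • x + c1 • y + c2 • z + c3 • w = 0 →
      c0 = 0 ∧ c1 = 0 ∧ c2 = 0 ∧ c3 = 0)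
    (hnd : ∀ u, (∀ v, b u v = 0) → u = 0)
    (bs : ∀ u v, b u v = b v u) (mc : ∀ u v, m u v = m v u)
    (inv : ∀ u v s, b (m u v) s = b v (m u s))
    (hx : ∀ u, m x u = u)
    (hzw : b (m z z) (m w w) - b (m z w) (m z w) ≠ 0)
    (h01 : b (m z w) (m y w) = b (m y z) (m w w))
    (h02 : b (m y z) (m z w) = b (m z z) (m y w))
    (h11 : b (m y y) (m w w) = b (m y w) (m y w))
    (h12 : b (m y z) (m y w) = b (m y y) (m z w))
    (h22 : b (m y y) (m z z) = b (m y z) (m y z)) :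
    ∃ c t b1 b2 : k,
      m y y = (-(c * (t - c))) • x + t • y ∧
      m y z = (-(c * b1)) • x + b1 • y + c • z ∧
      m y w = (-(c * b2)) • x + b2 • y + c • w ∧
      (∃ e1 e2 e3 : k, m z w =
        (-(e1 * (t - c) + e2 * b1 + e3 * b2 - b1 * b2)) • x + e1 • y + e2 • z + e3 • w) ∧
      (∃ e1 e2 e3 : k, m w w =
        (-(e1 * (t - c) + e2 * b1 + e3 * b2 - b2 * b2)) • x + e1 • y + e2 • z + e3 • w) := by
  have hx' : ∀ u, m u x = u := fun u => by rw [mc, hx]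
  have ext4 : ∀ u v, b u x = b v x → b u y = b v y → b u z = b v z → b u w = b v w → u = v := by
    intro u v h0 h1 h2 h3
    rw [← sub_eq_zero]
    apply hnd
    intro s
    obtain ⟨c0, c1, c2, c3, rfl⟩ := hspan s
    simp [h0, h1, h2, h3]
  have czy := mc z y
  have cwy := mc w y
  have cwz := mc w z
  have com : ∀ p q r, b (m q r) (m p y) = b (m p r) (m q y) →
      b (m q r) (m p z) = b (m p r) (m q z) → b (m q r) (m p w) = b (m p r) (m q w) →
      m p (m q r) = m q (m p r) := by
    intro p q r h1 h2 h3
    apply ext4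
    · have h : b (m q r) (m p x) = b (m p r) (m q x) := by
        rw [hx', hx', mc q r, bs (m p r), mc p r, inv r q p, bs]
      rw [inv p, h, ← inv q]
    · rw [inv p, h1, ← inv q]
    · rw [inv p, h2, ← inv q]
    · rw [inv p, h3, ← inv q]
  have k1 : m y (m y z) = m z (m y y) := by
    have := com y z y (by rw [czy]; exact bs _ _) (by rw [czy]; exact h22.symm)
      (by rw [czy]; exact h12)
    rwa [czy] at this
  have k2 : m y (m z w) = m z (m y w) :=
    com y z w (by rw [czy, bs, ← h12, bs]) (by rw [bs, h02, bs]) (bs _ _)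
  have k3 : m y (m z z) = m z (m y z) :=
    com y z z (by rw [czy, bs, h22]) (bs _ _) h02.symm
  have k4 : m y (m y w) = m w (m y y) := by
    have := com y w y (by rw [cwy]; exact bs _ _) (by rw [cwy, cwz, bs]; exact h12)
      (by rw [cwy]; exact h11.symm)
    rwa [cwy] at this
  have k5 : m y (m z w) = m w (m y z) := by
    have := com y w z (by rw [cwz, cwy, bs, ← h12]) (by rw [cwz]; exact bs _ _)
      (by rw [cwz]; exact h01)
    rwa [cwz] at this
  have k6 : m y (m w w) = m w (m y w) :=
    com y w w (by rw [cwy, bs, h11]) (by rw [cwz, bs, ← h01, bs]) (bs _ _)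
  have E1 : ∀ c0 c1 c2 c3 : k, ∀ u, u = c0 • x + c1 • y + c2 • z + c3 • w →
      b (m w u) (m z w) - b (m z u) (m w w) =
        -c2 * (b (m z z) (m w w) - b (m z w) (m z w)) := by
    rintro c0 c1 c2 c3 u rfl
    have e1 : b w (m z w) = b z (m w w) := by rw [← inv w, cwz, inv, bs, inv]
    have e2 := bs (m w w) (m z w)
    simp only [map_add, map_smul, LinearMap.add_apply, LinearMap.smul_apply, smul_eq_mul,
      hx', czy, cwy, cwz]
    grind
  have E2 : ∀ c0 c1 c2 c3 : k, ∀ u, u = c0 • x + c1 • y + c2 • z + c3 • w →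
      b (m w u) (m z z) - b (m z u) (m z w) =
        c3 * (b (m z z) (m w w) - b (m z w) (m z w)) := by
    rintro c0 c1 c2 c3 u rfl
    have e1 : b w (m z z) = b z (m z w) := by rw [← inv z, bs]
    have e2 := bs (m w w) (m z z)
    have e3 := bs (m z z) (m z w)
    have e4 := bs (m z z) (m y w)
    simp only [map_add, map_smul, LinearMap.add_apply, LinearMap.smul_apply, smul_eq_mul,
      hx', czy, cwy, cwz]
    grind
  obtain ⟨a0, t, p0, q0, hyy⟩ := hspan (m y y)
  obtain ⟨a1, b1, c, q1, hyz⟩ := hspan (m y z)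
  obtain ⟨a2, b2, p2, c', hyw⟩ := hspan (m y w)
  obtain ⟨e0, e1, e2, e3, hZW⟩ := hspan (m z w)
  obtain ⟨f0, f1, f2, f3, hWW⟩ := hspan (m w w)
  have hp0 : p0 = 0 := by
    have h := E1 _ _ _ _ _ hyy
    rw [← k4, ← k1, inv y (m y w), inv y (m y z), k5, k6, ← inv w (m y w), bs (m w (m y w)), sub_self] at h
    grind
  have hq0 : q0 = 0 := by
    have h := E2 _ _ _ _ _ hyy
    rw [← k4, ← k1, inv y (m y w), inv y (m y z), k3, k2, ← inv z (m y w), bs (m z (m y w)), sub_self] at h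
    grind
  have hq1 : q1 = 0 := by
    have h := E2 _ _ _ _ _ hyz
    rw [← k5, ← k3, inv y (m z w), bs (m z w), sub_self] at h
    grind
  have hp2 : p2 = 0 := by
    have h := E1 _ _ _ _ _ hyw
    rw [← k6, ← k2, inv y (m w w), bs (m w w), sub_self] at h
    grind
  have hc : c' = c := by
    have h1 := E1 _ _ _ _ _ hyz
    have h2 := E2 _ _ _ _ _ hyw
    rw [← k5, ← k3] at h1
    rw [← k6, ← k2] at h2
    have h3 : b (m y (m w w)) (m z z) = b (m y (m z z)) (m w w) := by rw [inv, bs]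
    have h4 : (c' - c) * (b (m z z) (m w w) - b (m z w) (m z w)) = 0 := by
      linear_combination -h1 - h2 + h3
    rcases mul_eq_zero.1 h4 with h | h
    · exact sub_eq_zero.1 h
    · exact absurd h hzw
  subst hp0 hq0 hq1 hp2 hc
  simp only [zero_smul, add_zero] at hyy hyz hyw
  have s1 : m z (m y w) = m w (m y z) := by rw [← k2, k5]
  simp only [hyw, hyz, map_add, map_smul, hx', czy, cwy, cwz] at s1
  obtain ⟨-, -, g1, g2⟩ := hind (b2 * a1 - b1 * a2) (b2 * b1 - b1 * b2) (a2 + b2 * c') (-(a1 + b1 * c')) (by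
    rw [← sub_eq_zero] at s1
    rw [← s1]
    module)
  have s2 := k1
  simp only [hyy, hyz, map_add, map_smul, hx', czy, cwy, cwz] at s2
  obtain ⟨-, -, g3, -⟩ := hind (b1 * a0 + c' * a1 - t * a1) (a1 + b1 * t + c' * b1 - t * b1)
    (c' * c' - a0 - t * c') 0 (by
    rw [← sub_eq_zero] at s2
    rw [← s2]
    module)
  have s3 := k2
  simp only [hZW, hyw, map_add, map_smul, hx', czy, cwy, cwz] at s3
  simp only [hZW, hyy, hyw, hyz] at s3
  obtain ⟨-, g4, -, -⟩ := hind (e1 * a0 + e2 * a1 + e3 * a2 - b2 * a1 - c' * e0)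
    (e0 + e1 * t + e2 * b1 + e3 * b2 - b2 * b1 - c' * e1)
    (e2 * c' - a2 - b2 * c' - c' * e2) (e3 * c' - c' * e3) (by
    rw [← sub_eq_zero] at s3
    rw [← s3]
    module)
  have s4 := k6
  simp only [hWW, hyw, map_add, map_smul, hx', czy, cwy, cwz] at s4
  simp only [hWW, hyy, hyw, hyz] at s4
  obtain ⟨-, g5, -, -⟩ := hind (f1 * a0 + f2 * a1 + f3 * a2 - b2 * a2 - c' * f0)
    (f0 + f1 * t + f2 * b1 + f3 * b2 - b2 * b2 - c' * f1)
    (f2 * c' - c' * f2) (f3 * c' - a2 - b2 * c' - c' * f3) (by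
    rw [← sub_eq_zero] at s4
    rw [← s4]
    module)
  refine ⟨c', t, b1, b2, ?_, ?_, ?_, ⟨e1, e2, e3, ?_⟩, ⟨f1, f2, f3, ?_⟩⟩
  · rw [hyy]; congr 2; linear_combination -g3
  · rw [hyz]; congr 3; linear_combination -g2
  · rw [hyw]; congr 3; linear_combination g1
  · rw [hZW]; congr 4; linear_combination g4
  · rw [hWW]; congr 4; linear_combination g5

/-- Auxiliary: the trilinear form. -/
def triForm (Φ : MvPolynomial (Fin 4) k →ₗ[k] k) :
    homogeneousSubmodule (Fin 4) k 1 →ₗ[k] homogeneousSubmodule (Fin 4) k 1 →ₗ[k]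
      (homogeneousSubmodule (Fin 4) k 1 →ₗ[k] k) :=
  LinearMap.mk₂ k (fun u v =>
    { toFun := fun t => Φ (u.1 * v.1 * t.1)
      map_add' := fun v w => by simp [mul_add]
      map_smul' := fun c v => by simp [mul_smul_comm] })
    (fun a b c => by ext v; simp [add_mul])
    (fun a b c => by ext v; simp [smul_mul_assoc])
    (fun a b c => by ext v; simp [add_mul, mul_add])
    (fun a b c => by ext v; simp [smul_mul_assoc, mul_smul_comm])

theorem triForm_apply (Φ : MvPolynomial (Fin 4) k →ₗ[k] k)
    (u v t : homogeneousSubmodule (Fin 4) k 1) :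
    triForm k Φ u v t = Φ (u.1 * v.1 * t.1) := rfl

theorem pMap_apply (Φ : MvPolynomial (Fin 4) k →ₗ[k] k)
    (u v : homogeneousSubmodule (Fin 4) k 1) :
    pMap k Φ u v = Φ (X 0 * u.1 * v.1) := rfl

theorem varCoeff_comb (c0 c1 c2 c3 : k) (i : Fin 4) :
    varCoeff k i (c0 • X 0 + c1 • X 1 + c2 • X 2 + c3 • X 3) = ![c0, c1, c2, c3] i := by
  fin_cases i <;>
    simp [varCoeff, MvPolynomial.coeff_X', Finsupp.single_left_inj]

/-- **Lemma 13.5** (the matrix `K₁` equals the Brown matrix `Br₁`).  Assume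
`Φ` is a degree-3 Macaulay inverse system on `P = k[x,y,z,w]` whose annihilator
contains no nonzero linear form, `p` is bijective, and `SM = diag(α,0,0)` with
`α ≠ 0`.  Then the five displayed polynomial identities hold in `P`. -/
theorem brown_matrix_identities
    (Φ : MvPolynomial (Fin 4) k →ₗ[k] k)
    (hΦ : ∀ m : Fin 4 →₀ ℕ, (m.sum fun _ e => e) ≠ 3 → Φ (monomial m 1) = 0)
    (hlin : ∀ u ∈ homogeneousSubmodule (Fin 4) k 1, u ∈ annIdeal k Φ → u = 0)
    (hp : Function.Bijective (pMap k Φ))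
    (ly2 lyz lyw lz2 lzw lw2 : MvPolynomial (Fin 4) k)
    (hly2m : ly2 ∈ homogeneousSubmodule (Fin 4) k 1)
    (hlyzm : lyz ∈ homogeneousSubmodule (Fin 4) k 1)
    (hlywm : lyw ∈ homogeneousSubmodule (Fin 4) k 1)
    (hlz2m : lz2 ∈ homogeneousSubmodule (Fin 4) k 1)
    (hlzwm : lzw ∈ homogeneousSubmodule (Fin 4) k 1)
    (hlw2m : lw2 ∈ homogeneousSubmodule (Fin 4) k 1)
    (hly2 : ∀ v ∈ homogeneousSubmodule (Fin 4) k 1,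
      Φ (X 0 * ly2 * v) = Φ (X 1 ^ 2 * v))
    (hlyz : ∀ v ∈ homogeneousSubmodule (Fin 4) k 1,
      Φ (X 0 * lyz * v) = Φ (X 1 * X 2 * v))
    (hlyw : ∀ v ∈ homogeneousSubmodule (Fin 4) k 1,
      Φ (X 0 * lyw * v) = Φ (X 1 * X 3 * v))
    (hlz2 : ∀ v ∈ homogeneousSubmodule (Fin 4) k 1,
      Φ (X 0 * lz2 * v) = Φ (X 2 ^ 2 * v))
    (hlzw : ∀ v ∈ homogeneousSubmodule (Fin 4) k 1,
      Φ (X 0 * lzw * v) = Φ (X 2 * X 3 * v))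
    (hlw2 : ∀ v ∈ homogeneousSubmodule (Fin 4) k 1,
      Φ (X 0 * lw2 * v) = Φ (X 3 ^ 2 * v))
    (α : k) (hα : α ≠ 0)
    (hSM : smMatrix k Φ ly2 lyz lyw lz2 lzw lw2 = !![α, 0, 0; 0, 0, 0; 0, 0, 0]) :
    X 1 ^ 2 - X 0 * ly2 = w1 k lyw * pi1 k ly2 lyw ∧
      X 1 * X 2 - X 0 * lyz = w1 k lyw * pi2 k lyz ∧
      X 1 * X 3 - X 0 * lyw = w1 k lyw * pi3 k lyw ∧
      X 2 * X 3 - X 0 * lzw =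
        -(u21 k lzw * pi1 k ly2 lyw + u22 k lzw * pi2 k lyz +
            u23 k lyz lzw * pi3 k lyw) ∧
      X 3 ^ 2 - X 0 * lw2 =
        -(u11 k lw2 * pi1 k ly2 lyw + u12 k lw2 * pi2 k lyz +
            u13 k lyw lw2 * pi3 k lyw) := by
  have hXm : ∀ i : Fin 4, (X i : MvPolynomial (Fin 4) k) ∈ homogeneousSubmodule (Fin 4) k 1 :=
    fun i => (mem_homogeneousSubmodule _ _).2 (isHomogeneous_X k i)
  let E := LinearEquiv.ofBijective (pMap k Φ) hp
  let m := (triForm k Φ).compr₂ E.symm.toLinearMap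
  have key : ∀ u v s, pMap k Φ (m u v) s = Φ (u.1 * v.1 * s.1) := by
    intro u v s
    have : pMap k Φ (m u v) = triForm k Φ u v := E.apply_symm_apply _
    rw [this, triForm_apply]
  have meq : ∀ u v (l : homogeneousSubmodule (Fin 4) k 1),
      (∀ s ∈ homogeneousSubmodule (Fin 4) k 1, Φ (X 0 * l.1 * s) = Φ (u.1 * v.1 * s)) →
      m u v = l := by
    intro u v l h
    apply hp.1
    ext s
    rw [key, pMap_apply, h _ s.2]
  let e : Fin 4 → homogeneousSubmodule (Fin 4) k 1 := fun i => ⟨X i, hXm i⟩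
  have hyy : m (e 1) (e 1) = ⟨ly2, hly2m⟩ :=
    meq _ _ _ fun s hs => by rw [hly2 s hs, pow_two]
  have hyz : m (e 1) (e 2) = ⟨lyz, hlyzm⟩ := meq _ _ _ hlyz
  have hyw : m (e 1) (e 3) = ⟨lyw, hlywm⟩ := meq _ _ _ hlyw
  have hzz : m (e 2) (e 2) = ⟨lz2, hlz2m⟩ :=
    meq _ _ _ fun s hs => by rw [hlz2 s hs, pow_two]
  have hzw : m (e 2) (e 3) = ⟨lzw, hlzwm⟩ := meq _ _ _ hlzw
  have hww : m (e 3) (e 3) = ⟨lw2, hlw2m⟩ :=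
    meq _ _ _ fun s hs => by rw [hlw2 s hs, pow_two]
  have ent : ∀ i j, smMatrix k Φ ly2 lyz lyw lz2 lzw lw2 i j =
      (!![α, 0, 0; 0, 0, 0; 0, 0, 0] : Matrix (Fin 3) (Fin 3) k) i j := fun i j => by rw [hSM]
  have h00 := ent 0 0
  have h01 := ent 0 1
  have h02 := ent 0 2
  have h11 := ent 1 1
  have h12 := ent 1 2
  have h22 := ent 2 2
  simp [smMatrix] at h00 h01 h02 h11 h12 h22
  have bs : ∀ u v, pMap k Φ u v = pMap k Φ v u := by
    intro u v
    rw [pMap_apply, pMap_apply]; congr 1; ring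
  have core := brown_core m (pMap k Φ) (e 0) (e 1) (e 2) (e 3)
    (by
      rintro ⟨u, hu⟩
      have hu' := hu
      rw [homogeneousSubmodule_one_eq_span_X, Submodule.mem_span_range_iff_exists_fun] at hu'
      obtain ⟨c, hc⟩ := hu'
      refine ⟨c 0, c 1, c 2, c 3, ?_⟩
      apply Subtype.ext
      rw [Fin.sum_univ_four] at hc
      exact hc.symm)
    (by
      intro c0 c1 c2 c3 h
      have h' : c0 • X 0 + c1 • X 1 + c2 • X 2 + c3 • X 3 = (0 : MvPolynomial (Fin 4) k) :=
        congrArg Subtype.val h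
      have hh : ∀ i, ![c0, c1, c2, c3] i = 0 := by
        intro i
        rw [← varCoeff_comb, h']
        simp [varCoeff]
      exact ⟨hh 0, hh 1, hh 2, hh 3⟩)
    (by
      intro u h
      apply hp.1
      rw [map_zero]
      ext v
      exact h v)
    bs
    (by
      intro u v
      apply hp.1
      ext s
      rw [key, key, mul_comm u.1])
    (by
      intro u v s
      rw [bs v, key, key]; congr 1; ring)
    (by
      intro u
      exact meq _ _ _ fun s hs => rfl)
    (by
      rw [key, key, hww, hzw]
      simp only [e]
      rw [← pow_two, h00]; exact hα)
    (by
      rw [key, key, hyw, hww, mul_comm (e 1).1]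
      exact sub_eq_zero.1 h01)
    (by
      rw [key, key, hzw, hyw]
      simp only [e]
      rw [← pow_two]; exact sub_eq_zero.1 h02)
    (by
      rw [key, key, hww, hyw]
      simp only [e]
      rw [← pow_two]; exact sub_eq_zero.1 h11)
    (by
      rw [key, key, hyw, hzw]
      simp only [e]
      rw [← pow_two]; exact sub_eq_zero.1 h12)
    (by
      rw [key, key, hzz, hyz]
      simp only [e]
      rw [← pow_two]; exact sub_eq_zero.1 h22)
  obtain ⟨c, t, b1, b2, q1, q2, q3, ⟨e1, e2, e3, q4⟩, ⟨f1, f2, f3, q5⟩⟩ := core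
  rw [hyy] at q1
  rw [hyz] at q2
  rw [hyw] at q3
  rw [hzw] at q4
  rw [hww] at q5
  have r1 : ly2 = (-(c * (t - c))) • X 0 + t • X 1 + (0 : k) • X 2 + (0 : k) • X 3 := by
    rw [zero_smul, zero_smul, add_zero, add_zero]; exact congrArg Subtype.val q1
  have r2 : lyz = (-(c * b1)) • X 0 + b1 • X 1 + c • X 2 + (0 : k) • X 3 := by
    rw [zero_smul, add_zero]; exact congrArg Subtype.val q2
  have r3 : lyw = (-(c * b2)) • X 0 + b2 • X 1 + (0 : k) • X 2 + c • X 3 := by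
    rw [zero_smul, add_zero]; exact congrArg Subtype.val q3
  have r4 := congrArg Subtype.val q4
  have r5 := congrArg Subtype.val q5
  change lzw = _ • X 0 + _ • X 1 + _ • X 2 + _ • X 3 at r4
  change lw2 = _ • X 0 + _ • X 1 + _ • X 2 + _ • X 3 at r5
  have v1 : ∀ i, varCoeff k i ly2 = _ := fun i => by rw [r1, varCoeff_comb]
  have v2 : ∀ i, varCoeff k i lyz = _ := fun i => by rw [r2, varCoeff_comb]
  have v3 : ∀ i, varCoeff k i lyw = _ := fun i => by rw [r3, varCoeff_comb]
  have v4 : ∀ i, varCoeff k i lzw = _ := fun i => by rw [r4, varCoeff_comb]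
  have v5 : ∀ i, varCoeff k i lw2 = _ := fun i => by rw [r5, varCoeff_comb]
  simp only [w1, pi1, pi2, pi3, u11, u12, u13, u21, u22, u23, v1, v2, v3, v4, v5]
  rw [r1, r2, r3, r4, r5]
  simp only [MvPolynomial.smul_eq_C_mul, Matrix.cons_val, map_neg, map_sub, map_mul, map_add,
    map_zero]
  refine ⟨?_, ?_, ?_, ?_, ?_⟩ <;> ring

end
end

section
/- With P = k[x,y,z,w], Φ a degree-3 Macaulay inverse system, ann Φ containing no nonzero linear form, p bijective, and SM = diag(α,0,0) with α ≠ 0, let J be the ideal of P generated by the five quadrics y² − x·ℓ_{y²}, yz − x·ℓ_{yz}, yw − x·ℓ_{yw}, zw − x·ℓ_{zw}, and w² − x·ℓ_{w²}. Then J is a perfect ideal of grade three: J contains a length-three regular sequence on P, and P/J admits a free resolution of the form 0 → P² → P⁶ → P⁵ → P (with the image of the last map equal to J). -/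
theorem algV {k V : Type*} [Field k] [AddCommGroup V] [Module k V]
    (m : V →ₗ[k] V →ₗ[k] V) (B : V →ₗ[k] V →ₗ[k] k) (x y z w : V)
    (mc : ∀ u v, m u v = m v u) (hBm : ∀ u v t, B (m u v) t = B (m u t) v)
    (mx : ∀ v, m x v = v) (nd : ∀ u, (∀ v, B u v = 0) → u = 0)
    (hs : ∀ v, ∃ a b c d : k, v = a • x + b • y + c • z + d • w)
    (hli : ∀ a b c d : k, a • x + b • y + c • z + d • w = 0 → a = 0 ∧ b = 0 ∧ c = 0 ∧ d = 0)
    (α : k) (hα : α ≠ 0)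
    (s1 : B (m z z) (m w w) - B (m z w) (m z w) = α)
    (s2 : B (m z w) (m y w) = B (m y z) (m w w))
    (s3 : B (m y z) (m z w) = B (m z z) (m y w))
    (s4 : B (m y y) (m w w) = B (m y w) (m y w))
    (s5 : B (m y z) (m y w) = B (m y y) (m z w))
    (s6 : B (m y y) (m z z) = B (m y z) (m y z)) :
    ∃ c d b1 b2 p1 p2 p3 q1 q2 q3 : k,
      m y y = (c+d) • y - (c*d) • x ∧
      m y z = b1 • y + c • z - (c*b1) • x ∧
      m y w = b2 • y + c • w - (c*b2) • x ∧
      m z w = b1 • w + b2 • z - (b1*b2) • x + p1 • (y-d • x)+p2 • (z-b1 • x)+p3 • (w-b2 • x) ∧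
      m w w = (2*b2) • w - (b2*b2) • x + q1 • (y-d • x)+q2 • (z-b1 • x)+q3 • (w-b2 • x) ∧
      ¬ (q2 = 0 ∧ p2*p3 = p1*(d-c) ∧ p2*p2 = q3*p2 - q1*(d-c)) := by
  have mx' : ∀ v, m v x = v := fun v => by rw [mc, mx]
  have Bs : ∀ u v, B u v = B v u := fun u v => by
    have := hBm x u v; rwa [mx, mx] at this
  have adj : ∀ u v t, B (m u v) t = B v (m u t) := fun u v t => by rw [hBm, Bs]
  have key : ∀ f g : V →ₗ[k] k, f x = g x → f y = g y → f z = g z → f w = g w →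
      ∀ v, f v = g v := by
    intro f g h1 h2 h3 h4 v
    obtain ⟨a, b, c, d, rfl⟩ := hs v
    simp only [map_add, map_smul, h1, h2, h3, h4]
  have hN0 : ∀ u v t, B (m u v) (m y t) = B (m y u) (m v t) := by
    have c1 : m z y = m y z := mc _ _
    have c2 : m w y = m y w := mc _ _
    have c3 : m w z = m z w := mc _ _
    have e1 := Bs (m y y) (m y z)
    have e2 := Bs (m y y) (m y w)
    have e3 := Bs (m y y) (m z z)
    have e4 := Bs (m y y) (m z w)
    have e5 := Bs (m y y) (m w w)
    have e6 := Bs (m y z) (m y w)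
    have e7 := Bs (m y z) (m z z)
    have e8 := Bs (m y z) (m z w)
    have e9 := Bs (m y z) (m w w)
    have e10 := Bs (m y w) (m z z)
    have e11 := Bs (m y w) (m z w)
    have e12 := Bs (m y w) (m w w)
    have base : ∀ u v t, (u = x ∨ u = y ∨ u = z ∨ u = w) → (v = x ∨ v = y ∨ v = z ∨ v = w) →
        (t = x ∨ t = y ∨ t = z ∨ t = w) → B (m u v) (m y t) = B (m y u) (m v t) := by
      intro u v t hu hv ht
      rcases hu with rfl | hu
      · rw [mx, mx', Bs v, Bs y, mc y t, mc v t]; exact hBm _ _ _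
      rcases hv with rfl | hv
      · rw [mx, mx', ← adj]
      rcases ht with rfl | ht
      · rw [mx', mx', mc y u]; exact hBm _ _ _
      rcases hu with rfl | rfl | rfl <;> rcases hv with rfl | rfl | rfl <;>
        rcases ht with rfl | rfl | rfl <;> (try simp only [c1, c2, c3]) <;> grind
    have main : ∀ u v t, (t = x ∨ t = y ∨ t = z ∨ t = w) → B (m u v) (m y t) = B (m y u) (m v t) := by
      intro u v t hh
      have : ∀ v', (v' = x ∨ v' = y ∨ v' = z ∨ v' = w) →
          B (m u v') (m y t) = B (m y u) (m v' t) := by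
        intro v' hv'
        have := key (B.flip (m y t) ∘ₗ m v') (B.flip (m v' t) ∘ₗ m y)
          (by change B (m v' x) (m y t) = B (m y x) (m v' t); rw [mc v' x]; exact base x v' t (by simp) hv' hh)
          (by change B (m v' y) (m y t) = B (m y y) (m v' t); rw [mc v' y]; exact base y v' t (by simp) hv' hh)
          (by change B (m v' z) (m y t) = B (m y z) (m v' t); rw [mc v' z]; exact base z v' t (by simp) hv' hh)
          (by change B (m v' w) (m y t) = B (m y w) (m v' t); rw [mc v' w]; exact base w v' t (by simp) hv' hh) u
        change B (m v' u) (m y t) = B (m y u) (m v' t) at this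
        rwa [mc v' u] at this
      have := key (B.flip (m y t) ∘ₗ m u) (B (m y u) ∘ₗ m t)
          (by change B (m u x) (m y t) = B (m y u) (m t x); rw [mc t x]; exact this x (by simp))
          (by change B (m u y) (m y t) = B (m y u) (m t y); rw [mc t y]; exact this y (by simp))
          (by change B (m u z) (m y t) = B (m y u) (m t z); rw [mc t z]; exact this z (by simp))
          (by change B (m u w) (m y t) = B (m y u) (m t w); rw [mc t w]; exact this w (by simp)) v
      change B (m u v) (m y t) = B (m y u) (m t v) at this
      rwa [mc t v] at this
    intro u v t
    exact key (B (m u v) ∘ₗ m y) (B (m y u) ∘ₗ m v) (main u v x (by simp)) (main u v y (by simp))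
      (main u v z (by simp)) (main u v w (by simp)) t
  have hN : ∀ u v, m y (m u v) = m (m y u) v := by
    intro u v
    rw [← sub_eq_zero]
    apply nd
    intro t
    rw [map_sub, LinearMap.sub_apply, adj y (m u v) t, hN0 u v t, mc (m y u) v, adj v (m y u) t, sub_self]
  -- dual functionals
  have ew : ∀ a b c d : k, B (m z z) (m w (a • x + b • y + c • z + d • w)) -
      B (m z w) (m z (a • x + b • y + c • z + d • w)) = α * d := by
    intro a b c d
    have h1 : B (m z z) w = B (m z w) z := hBm _ _ _
    have h2 : B (m z z) (m w z) = B (m z w) (m z z) := by rw [mc w z, Bs]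
    have h3 : B (m z z) (m w y) = B (m z w) (m z y) := by
      rw [mc w y, mc z y, ← s3, Bs]
    simp only [map_add, map_smul, smul_eq_mul, mx', h1, h2, h3]
    linear_combination d * s1
  have ez : ∀ a b c d : k, B (m w w) (m z (a • x + b • y + c • z + d • w)) -
      B (m z w) (m w (a • x + b • y + c • z + d • w)) = α * c := by
    intro a b c d
    have h1 : B (m w w) z = B (m z w) w := by rw [hBm, mc w z]
    have h2 : B (m w w) (m z w) = B (m z w) (m w w) := by rw [Bs]
    have h3 : B (m w w) (m z y) = B (m z w) (m w y) := by
      rw [mc w y, mc z y, s2, Bs]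
    have h4 : B (m w w) (m z z) = B (m z z) (m w w) := by rw [Bs]
    simp only [map_add, map_smul, smul_eq_mul, mx', h1, h2, h3, h4, mc w z]
    linear_combination c * s1
  have hN2 : ∀ u v, m u (m y v) = m y (m u v) := by
    intro u v; rw [mc u v, hN, mc]
  obtain ⟨a0, b0, c0, d0, hyy⟩ := hs (m y y)
  obtain ⟨a1, b1, c1, d1, hyz⟩ := hs (m y z)
  obtain ⟨a2, b2, c2, d2, hyw⟩ := hs (m y w)
  have adjy : ∀ u v, B u (m y v) = B (m y u) v := fun u v => (adj _ _ _).symm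
  have L1 : ∀ a b, B (m a a) (m b (m y y)) = B (m a b) (m a (m y y)) := by
    intro a b
    rw [hN2 b y, hN2 a y, adjy, adjy, hN a a, mc (m y a) a, adj a (m y a), mc a b, hN b a,
      mc (m y b) a, Bs (m a (m y b)), mc b y, mc a y]
  have L2 : ∀ a b, B (m a a) (m b (m y a)) = B (m a b) (m a (m y a)) := by
    intro a b
    rw [hN2 b a, hN2 a a, adjy, Bs, mc b a]
  have hd0 : d0 = 0 := by
    have := ew a0 b0 c0 d0
    rw [← hyy, L1, sub_self] at this
    simpa [hα] using this.symm
  have hc0 : c0 = 0 := by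
    have := ez a0 b0 c0 d0
    rw [← hyy, L1, mc w z, sub_self] at this
    simpa [hα] using this.symm
  have hd1 : d1 = 0 := by
    have := ew a1 b1 c1 d1
    rw [← hyz, L2, sub_self] at this
    simpa [hα] using this.symm
  have hc2 : c2 = 0 := by
    have := ez a2 b2 c2 d2
    rw [← hyw, L2, mc w z, sub_self] at this
    simpa [hα] using this.symm
  have hcd : c1 = d2 := by
    have h1 := ez a1 b1 c1 d1
    have h2 := ew a2 b2 c2 d2
    rw [← hyz, hN2, hN2, mc w z, adjy, Bs] at h1
    rw [← hyw, hN2, hN2] at h2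
    exact mul_left_cancel₀ hα (h1.symm.trans h2)
  subst hd0 hc0 hd1 hc2 hcd
  simp only [zero_smul, add_zero] at hyy hyz hyw
  obtain ⟨a3, b3, c3, d3, hzw⟩ := hs (m z w)
  obtain ⟨a4, b4, c4, d4, hww⟩ := hs (m w w)
  have E1 := hN y z
  have E2 := hN y w
  have E3 := hN z w
  have E4 := hN w w
  simp only [hyy, hyz, hyw, hzw, hww, map_add, map_smul, LinearMap.add_apply,
    LinearMap.smul_apply, mx, mx'] at E1 E2 E3 E4
  obtain ⟨-, f1, f2, -⟩ := hli (b1*a0 + c1*a1 - b0*a1) (a1 + b1*b0 + c1*b1 - b0*b1)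
    (c1*c1 - a0 - b0*c1) 0 (by rw [← sub_eq_zero] at E1; rw [← E1]; module)
  obtain ⟨-, f3, -, -⟩ := hli (b2*a0 + c1*a2 - b0*a2) (a2 + b2*b0 + c1*b2 - b0*b2)
    0 (c1*c1 - a0 - b0*c1) (by rw [← sub_eq_zero] at E2; rw [← E2]; module)
  obtain ⟨-, f4, -, -⟩ := hli (b3*a0 + c3*a1 + d3*a2 - b1*a2 - c1*a3)
    (a3 + b3*b0 + c3*b1 + d3*b2 - b1*b2 - c1*b3)
    (c3*c1 - c1*c3) (d3*c1 - a1 - b1*c1 - c1*d3) (by rw [← sub_eq_zero] at E3; rw [← E3]; module)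
  obtain ⟨-, f5, -, -⟩ := hli (b4*a0 + c4*a1 + d4*a2 - b2*a2 - c1*a4)
    (a4 + b4*b0 + c4*b1 + d4*b2 - b2*b2 - c1*b4)
    (c4*c1 - c1*c4) (d4*c1 - a2 - b2*c1 - c1*d4) (by rw [← sub_eq_zero] at E4; rw [← E4]; module)
  have g0 : a0 = c1*c1 - b0*c1 := by linear_combination -f2
  have g1 : a1 = -c1*b1 := by linear_combination f1
  have g2 : a2 = -c1*b2 := by linear_combination f3
  have g3 : a3 = -(b3*b0 + c3*b1 + d3*b2 - b1*b2 - c1*b3) := by linear_combination f4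
  have g4 : a4 = -(b4*b0 + c4*b1 + d4*b2 - b2*b2 - c1*b4) := by linear_combination f5
  refine ⟨c1, b0 - c1, b1, b2, b3, c3 - b2, d3 - b1, b4, c4, d4 - 2*b2, ?_, ?_, ?_, ?_, ?_, ?_⟩
  · rw [hyy, g0]; module
  · rw [hyz, g1]; module
  · rw [hyw, g2]; module
  · rw [hzw, g3]; module
  · rw [hww, g4]; module
  · rintro ⟨h1, h2, h3⟩
    have A : m w (m z w) - m z (m w w) = (b3 * b2 + c3 * b3 + d3 * b4 - b4 * b1 - d4 * b3) • (y - c1 • x) := by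
      rw [hzw, hww]
      simp only [map_add, map_smul, mx', mc w y, mc w z, mc z y, hyy, hyz, hyw, hzw, hww, h1]
      rw [g1, g2, g3, g4, h1]
      match_scalars <;> grind
    have A1 : ∀ t, B (m w (m z w) - m z (m w w)) t = B (m z w) (m w t) - B (m w w) (m z t) := by
      intro t; rw [map_sub, LinearMap.sub_apply, adj w, adj z (m w w)]
    have t1 := A1 x
    have t2 := A1 z
    have u1 := ez 1 0 0 0
    have u2 := ez 0 0 1 0
    have u3 : B y z = b1 * B y x + c1 * B z x - c1 * b1 * B x x := by
      have : B y z = B (m y z) x := by rw [hBm, mx']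
      rw [this, hyz, g1]; simp; ring
    have u4 := Bs z x
    simp only [zero_smul, one_smul, add_zero, zero_add] at u1 u2
    rw [A] at t1 t2
    simp only [map_smul, map_sub, LinearMap.sub_apply, LinearMap.smul_apply, smul_eq_mul] at t1 t2
    apply hα
    generalize (b3 * b2 + c3 * b3 + d3 * b4 - b4 * b1 - d4 * b3) = μ at *
    grind

section cop
open Polynomial

theorem cop_gen {A : Type*} [CommRing A] [IsDomain A] [UniqueFactorizationMonoid A]
    (N : A[X]) (r : A) (hr : r ≠ 0)
    (h : ∀ π : A, Prime π → π ∣ r → (∀ i, π ∣ N.coeff i) → False) : IsRelPrime N (C r) := by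
  apply IsRelPrime.symm
  rw [UniqueFactorizationMonoid.isRelPrime_iff_no_prime_factors (C_ne_zero.2 hr)]
  intro π h2 h1 hπ
  have hd : π.natDegree = 0 := by
    have := natDegree_le_of_dvd h2 (by simpa using hr)
    simpa using this
  obtain ⟨a, rfl⟩ := natDegree_eq_zero.1 hd
  exact h a (prime_C_iff.1 hπ) (by
    have := (C_dvd_iff_dvd_coeff _ _).1 h2 0
    simpa using this) ((C_dvd_iff_dvd_coeff _ _).1 h1)

variable {k : Type*} [Field k]

theorem prime_x_W (π : k[X][X]) (hπ : Prime π) (h1 : π ∣ C X) (h2 : π ∣ X) : False := by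
  have hd : π.natDegree = 0 := by
    have := natDegree_le_of_dvd h1 (by simp)
    simpa using this
  obtain ⟨a, rfl⟩ := natDegree_eq_zero.1 hd
  have := (C_dvd_iff_dvd_coeff _ _).1 h2 1
  rw [coeff_X_one] at this
  exact hπ.not_isUnit ((isUnit_of_dvd_one this).map C)

/-- the cubic -/
noncomputable def cubR (p2 p3 q2 q3 e g : k) : k[X][X] :=
  (X - C (C p2 * X)) * (X^2 - C (C q3 * X) * X + C (C g * X^2)) +
    C (C q2 * X) * (- C (C p3 * X) * X + C (C e * X^2))

theorem cubR_x (p2 p3 q2 q3 e g : k) (π : k[X][X]) (hπ : Prime π) (h1 : π ∣ C X)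
    (h2 : π ∣ cubR p2 p3 q2 q3 e g) : False := by
  have h3 : π ∣ X ^ 3 := by
    have : C X ∣ cubR p2 p3 q2 q3 e g - X^3 := by
      unfold cubR
      simp only [C_mul, C_pow]
      refine ⟨-C (C q3) * X * X + C (C g) * C X * X - C (C p2) * (X^2 - C (C q3) * C X * X + C (C g) * C X^2)
        + C (C q2) * (- (C (C p3) * C X) * X + C (C e) * C X ^2), ?_⟩
      ring
    have := (dvd_sub h2 (h1.trans this))
    simpa using this
  exact prime_x_W π hπ h1 (hπ.dvd_of_dvd_pow h3)

theorem cubR_ne (p2 p3 q2 q3 e g : k) : cubR p2 p3 q2 q3 e g ≠ 0 := by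
  intro h
  have hp : Prime (C X : k[X][X]) := prime_C_iff.2 prime_X
  exact cubR_x p2 p3 q2 q3 e g (C X) hp dvd_rfl (h ▸ dvd_zero _)

theorem cop2 (p2 p3 q2 q3 e g : k) (hn : ¬ (q2 = 0 ∧ p2*p3 = e ∧ p2*p2 = q3*p2 - g)) :
    IsRelPrime (C (- C (C p3 * X) * X + C (C e * X^2)) +
      C ((X - C (C p2 * X)) + (X^2 - C (C q3 * X) * X + C (C g * X^2))) * X +
      C (- C (C q2 * X)) * X^2) (C (cubR p2 p3 q2 q3 e g)) := by
  apply cop_gen _ _ (cubR_ne p2 p3 q2 q3 e g)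
  intro π hπ hr h
  have h0 := h 0
  have h1 := h 1
  have h2 := h 2
  simp only [coeff_add, coeff_C_mul, coeff_X_pow, coeff_C, coeff_X] at h0 h1 h2
  norm_num at h0 h1 h2
  by_cases hq : q2 = 0
  · subst hq
    have h3 : π ∣ (X - C (C p2 * X)) * (X^2 - C (C q3 * X) * X + C (C g * X^2)) := by
      simpa [cubR] using hr
    have h4 : π ∣ (X - C (C p2 * X)) ∧ π ∣ (X^2 - C (C q3 * X) * X + C (C g * X^2)) := by
      rcases hπ.dvd_or_dvd h3 with h5 | h5
      · exact ⟨h5, (dvd_add_right h5).1 (by simpa using h1)⟩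
      · exact ⟨(dvd_add_left h5).1 (by simpa using h1), h5⟩
    have h5 : X - C (C p2 * X) ∣ π :=
      (hπ.irreducible.associated_of_dvd (prime_X_sub_C _).irreducible h4.1).symm.dvd
    have h6 := dvd_iff_isRoot.1 (h5.trans h4.2)
    have h7 : X - C (C p2 * X) ∣ (- C (C p3 * X) * X + C (C e * X^2)) :=
      h5.trans (by simpa using h0)
    have h8 := dvd_iff_isRoot.1 h7
    simp only [IsRoot, eval_add, eval_sub, eval_mul, eval_pow, eval_X, eval_C, eval_neg] at h6 h8
    have h9 := congrArg (fun p => eval 1 p) h6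
    have h10 := congrArg (fun p => eval 1 p) h8
    simp at h9 h10
    exact hn ⟨rfl, by linear_combination -h10, by linear_combination h9⟩
  · refine cubR_x p2 p3 q2 q3 e g π hπ ?_ hr
    have : C X = C (C q2⁻¹) * (C (C q2) * C X : k[X][X]) := by
      have h' : C (C q2⁻¹) * C (C q2) = (1 : k[X][X]) := by
        rw [← C_mul, ← C_mul, inv_mul_cancel₀ hq]; simp
      rw [← mul_assoc, h', one_mul]
    rw [this]
    exact Dvd.dvd.mul_left (dvd_neg.1 h2) _

theorem cop3 (p2 p3 q2 q3 b0 : k) (hb : b0 ≠ 0) :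
    IsRelPrime (C (- C (C p3 * X) * X) +
      C ((X - C (C p2 * X)) + (X^2 - C (C q3 * X) * X)) * X +
      C (- C (C q2 * X)) * X^2 + C (C (C b0 * X)) * X^3) (C (cubR p2 p3 q2 q3 0 0)) := by
  apply cop_gen _ _ (cubR_ne p2 p3 q2 q3 0 0)
  intro π hπ hr h
  have h2 := h 3
  simp only [coeff_add, coeff_C_mul, coeff_X_pow, coeff_C, coeff_X] at h2
  norm_num at h2
  refine cubR_x p2 p3 q2 q3 0 0 π hπ ?_ hr
  have : C X = C (C b0⁻¹) * (C (C b0) * C X : k[X][X]) := by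
    have h' : C (C b0⁻¹) * C (C b0) = (1 : k[X][X]) := by
      rw [← C_mul, ← C_mul, inv_mul_cancel₀ hb]; simp
    rw [← mul_assoc, h', one_mul]
  rw [this]
  exact Dvd.dvd.mul_left (by simpa using h2) _

end cop

theorem psi_ex {k : Type*} [Field k] (t b1 b2 : k) :
    ∃ (ψ : MvPolynomial (Fin 4) k →+* Polynomial (Polynomial (Polynomial k)))
      (s : Polynomial (Polynomial (Polynomial k)) →+* MvPolynomial (Fin 4) k),
      (∀ f, ψ (s f) = f) ∧
      (∀ f, ψ f = 0 ↔ (MvPolynomial.X 1 - MvPolynomial.C t * MvPolynomial.X 0) ∣ f) ∧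
      (∀ a, ψ (MvPolynomial.C a) = Polynomial.C (Polynomial.C (Polynomial.C a))) ∧
      ψ (MvPolynomial.X 0) = Polynomial.C (Polynomial.C Polynomial.X) ∧
      ψ (MvPolynomial.X 1) = Polynomial.C (Polynomial.C (Polynomial.C t)) * Polynomial.C (Polynomial.C Polynomial.X) ∧
      ψ (MvPolynomial.X 2) = Polynomial.X + Polynomial.C (Polynomial.C (Polynomial.C b1)) * Polynomial.C (Polynomial.C Polynomial.X) ∧
      ψ (MvPolynomial.X 3) = Polynomial.C Polynomial.X + Polynomial.C (Polynomial.C (Polynomial.C b2)) * Polynomial.C (Polynomial.C Polynomial.X) := by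
  let x : Polynomial (Polynomial (Polynomial k)) := Polynomial.C (Polynomial.C Polynomial.X)
  let κ : k →+* Polynomial (Polynomial (Polynomial k)) :=
    (Polynomial.C).comp ((Polynomial.C).comp Polynomial.C)
  let ψ : MvPolynomial (Fin 4) k →+* Polynomial (Polynomial (Polynomial k)) :=
    MvPolynomial.eval₂Hom κ ![x, κ t * x, Polynomial.X + κ b1 * x, Polynomial.C Polynomial.X + κ b2 * x]
  let s : Polynomial (Polynomial (Polynomial k)) →+* MvPolynomial (Fin 4) k :=
    Polynomial.eval₂RingHom (Polynomial.eval₂RingHom (Polynomial.eval₂RingHom MvPolynomial.C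
      (MvPolynomial.X 0)) (MvPolynomial.X 3 - MvPolynomial.C b2 * MvPolynomial.X 0))
      (MvPolynomial.X 2 - MvPolynomial.C b1 * MvPolynomial.X 0)
  have hC : ∀ a, ψ (MvPolynomial.C a) = Polynomial.C (Polynomial.C (Polynomial.C a)) := by
    intro a; simp [ψ, κ]
  have h0 : ψ (MvPolynomial.X 0) = Polynomial.C (Polynomial.C Polynomial.X) := by simp [ψ, x]
  have h1 : ψ (MvPolynomial.X 1) = Polynomial.C (Polynomial.C (Polynomial.C t)) * Polynomial.C (Polynomial.C Polynomial.X) := by simp [ψ, x, κ]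
  have h2 : ψ (MvPolynomial.X 2) = Polynomial.X + Polynomial.C (Polynomial.C (Polynomial.C b1)) * Polynomial.C (Polynomial.C Polynomial.X) := by simp [ψ, x, κ]
  have h3 : ψ (MvPolynomial.X 3) = Polynomial.C Polynomial.X + Polynomial.C (Polynomial.C (Polynomial.C b2)) * Polynomial.C (Polynomial.C Polynomial.X) := by simp [ψ, x, κ]
  have sC : ∀ a, s (Polynomial.C (Polynomial.C (Polynomial.C a))) = MvPolynomial.C a := by
    intro a; simp [s]
  have s0 : s (Polynomial.C (Polynomial.C Polynomial.X)) = MvPolynomial.X 0 := by simp [s]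
  have s1 : s (Polynomial.C Polynomial.X) = MvPolynomial.X 3 - MvPolynomial.C b2 * MvPolynomial.X 0 := by simp [s]
  have s2 : s Polynomial.X = MvPolynomial.X 2 - MvPolynomial.C b1 * MvPolynomial.X 0 := by simp [s]
  clear_value ψ s
  clear κ x
  have e1 : ∀ f, ψ (s f) = f := by
    have : ψ.comp s = RingHom.id _ := by
      apply Polynomial.ringHom_ext'
      · apply Polynomial.ringHom_ext'
        · apply Polynomial.ringHom_ext'
          · ext1 a
            simp only [RingHom.comp_apply, RingHom.id_apply, sC, hC]
          · simp only [RingHom.comp_apply, RingHom.id_apply, s0, h0]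
        · simp only [RingHom.comp_apply, RingHom.id_apply, s1, map_sub, map_mul, hC, h0, h3]
          ring
      · simp only [RingHom.comp_apply, RingHom.id_apply, s2, map_sub, map_mul, hC, h0, h2]
        ring
    intro f; exact congrArg (fun g : _ →+* _ => g f) this
  have e2 : ∀ f, (MvPolynomial.X 1 - MvPolynomial.C t * MvPolynomial.X 0) ∣ s (ψ f) - f := by
    intro f
    have : (Ideal.Quotient.mk (Ideal.span {(MvPolynomial.X 1 - MvPolynomial.C t * MvPolynomial.X 0 : MvPolynomial (Fin 4) k)})).comp (s.comp ψ) = Ideal.Quotient.mk _ := by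
      apply MvPolynomial.ringHom_ext
      · intro r; simp only [RingHom.comp_apply, sC, hC]
      · intro i
        fin_cases i
        · simp only [RingHom.comp_apply, Fin.zero_eta, h0, s0]
        · simp only [RingHom.comp_apply, Fin.mk_one, h1, map_mul, s0, sC]
          rw [← map_mul, eq_comm, Ideal.Quotient.eq]
          exact Ideal.mem_span_singleton_self _
        · simp only [RingHom.comp_apply, Fin.reduceFinMk, h2, map_mul, map_add, s0, sC, s2, map_sub]
          ring
        · simp only [RingHom.comp_apply, Fin.reduceFinMk, h3, map_mul, map_add, s0, sC, s1, map_sub]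
          ring
    rw [← Ideal.mem_span_singleton, ← Ideal.Quotient.eq]
    exact congrArg (fun g : _ →+* _ => g f) this
  refine ⟨ψ, s, e1, ?_, hC, h0, h1, h2, h3⟩
  intro f
  constructor
  · intro h
    have := e2 f
    rw [h, map_zero, zero_sub, dvd_neg] at this
    exact this
  · rintro ⟨g, rfl⟩
    rw [map_mul, map_sub, map_mul, hC, h0, h1, sub_self, zero_mul]

section ret
variable {k : Type*} [Field k]
theorem retr_prime {P S : Type*} [CommRing P] [IsDomain P] [CommRing S] [IsDomain S]
    (ψ : P →+* S) (Y : P) (hk : ∀ f, ψ f = 0 ↔ Y ∣ f) (h0 : Y ≠ 0) : Prime Y := by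
  refine ⟨h0, ?_, ?_⟩
  · intro h
    have := (hk 1).2 h.dvd
    rw [map_one] at this
    exact one_ne_zero this
  · intro a b h
    rw [← hk, map_mul, mul_eq_zero, hk, hk] at h
    exact h

theorem retr_reg {P S : Type*} [CommRing P] [CommRing S] [IsDomain S]
    [UniqueFactorizationMonoid S]
    (ψ : P →+* S) (s : S →+* P) (e1 : ∀ f, ψ (s f) = f) (Y : P) (hk : ∀ f, ψ f = 0 ↔ Y ∣ f)
    (a Q : P) (hr : IsRelPrime (ψ a) (ψ Q)) (f v : P) (h : Y ∣ a * f - Q * v) :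
    ∃ g, Y ∣ f - Q * g := by
  rw [← hk, map_sub, map_mul, map_mul, sub_eq_zero] at h
  have h1 : ψ Q ∣ ψ f := hr.symm.dvd_of_dvd_mul_left ⟨ψ v, h⟩
  obtain ⟨g, hg⟩ := h1
  exact ⟨s g, by rw [← hk, map_sub, map_mul, e1, hg, sub_self]⟩

theorem retr_syz {P S : Type*} [CommRing P] [CommRing S] [IsDomain S]
    [UniqueFactorizationMonoid S]
    (ψ : P →+* S) (s : S →+* P) (e1 : ∀ f, ψ (s f) = f) (Y : P) (hk : ∀ f, ψ f = 0 ↔ Y ∣ f)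
    (F G : P) (hG : ψ G ≠ 0) (hr : IsRelPrime (ψ F) (ψ G)) (a b : P) (h : Y ∣ a * F + b * G) :
    ∃ h, Y ∣ a - h * G ∧ Y ∣ b + h * F := by
  rw [← hk, map_add, map_mul, map_mul] at h
  have h1 : ψ G ∣ ψ a := hr.symm.dvd_of_dvd_mul_right ⟨-ψ b, by linear_combination h⟩
  obtain ⟨g, hg⟩ := h1
  refine ⟨s g, by rw [← hk, map_sub, map_mul, e1, hg]; ring, ?_⟩
  rw [← hk, map_add, map_mul, e1]
  rw [hg] at h
  apply mul_left_cancel₀ hG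
  linear_combination h

theorem retr_rel {P S : Type*} [CommRing P] [CommRing S]
    (ψ : P →+* S) (Y Z F G A B a Q : P) (vY : ψ Y = 0) (ha : a = F + Z * G + (Y * Z) * Z ^ 2)
    (hQ : Q = A * G + B * F) (rel : IsRelPrime (ψ a) (ψ Q)) : IsRelPrime (ψ F) (ψ G) := by
  intro δ d1 d2
  apply rel
  · rw [ha, map_add, map_add, map_mul, map_mul, map_mul, vY, zero_mul, zero_mul, add_zero]
    exact dvd_add d1 (d2.mul_left _)
  · rw [hQ, map_add, map_mul, map_mul]
    exact dvd_add (d2.mul_left _) (d1.mul_left _)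

theorem retr_kos {P S : Type*} [CommRing P] [CommRing S]
    (ψ : P →+* S) (s : S →+* P) (e1 : ∀ f, ψ (s f) = f) (T Z W : P)
    (hk : ∀ f, ψ f = 0 ↔ T ∣ f) (hZ : Prime (ψ Z)) (hW : ¬ ψ Z ∣ ψ W) (u v t : P)
    (h : u * T + v * Z + t * W = 0) : ∃ c1 c2, t = c1 * T + c2 * Z := by
  have vT : ψ T = 0 := (hk T).2 dvd_rfl
  have h' := congrArg ψ h
  rw [map_add, map_add, map_mul, map_mul, map_mul, vT, map_zero, mul_zero, zero_add] at h'
  have hd : ψ Z ∣ ψ t * ψ W := ⟨-ψ v, by linear_combination h'⟩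
  obtain ⟨g, hg⟩ := (hZ.dvd_or_dvd hd).resolve_right hW
  have : T ∣ t - Z * s g := by
    rw [← hk, map_sub, map_mul, e1, hg, sub_self]
  obtain ⟨r, hr⟩ := this
  exact ⟨r, s g, by linear_combination hr⟩

open Polynomial in
theorem G_ne (b0 q1 q2 q3 : k) : (-(C (C (C q1)) * C (C X)) * (-C (C (C b0)) * C (C X)) +
    -(C (C (C q2)) * C (C X)) * X + (C X - C (C (C q3)) * C (C X)) * C X : k[X][X][X]) ≠ 0 := by
  intro h
  have e : (-(C (C (C q1)) * C (C X)) * (-C (C (C b0)) * C (C X)) +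
    -(C (C (C q2)) * C (C X)) * X + (C X - C (C (C q3)) * C (C X)) * C X : k[X][X][X])
    = C (X ^ 2 - C (C q3 * X) * X + C (C (q1 * b0) * X ^ 2)) + C (- C (C q2 * X)) * X := by
    simp only [map_sub, map_mul, map_add, map_neg, map_pow]; ring
  rw [e] at h
  have h' := congrArg (fun p => p.coeff 0) h
  simp only [coeff_add, coeff_C_zero, mul_coeff_zero, coeff_X_zero, mul_zero, add_zero,
    coeff_zero] at h'
  have h3 := congrArg (fun p => p.coeff 2) h'
  simp only [coeff_add, coeff_sub, coeff_C_mul, coeff_X_pow, coeff_C, coeff_X] at h3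
  norm_num at h3
end ret

theorem resA {R : Type*} [CommRing R] [IsDomain R] (Y T Z W F G F1 F2 F3 G1 G2 G3 : R)
    (hF : F = F1*T + F2*Z + F3*W) (hG : G = G1*T + G2*Z + G3*W) (hT : T ≠ 0) (hY : Prime Y)
    (hTZ : ∀ a, T ∣ Z * a → T ∣ a)
    (hTZW : ∀ a b c, a * T + b * Z + c * W = 0 → ∃ c1 c2, c = c1 * T + c2 * Z)
    (hYG : ¬ Y ∣ G)
    (hFG : ∀ a b, Y ∣ a * F + b * G → ∃ h, Y ∣ a - h * G ∧ Y ∣ b + h * F) :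
    ∃ (d₃ : (Fin 2 → R) →ₗ[R] (Fin 6 → R)) (d₂ : (Fin 6 → R) →ₗ[R] (Fin 5 → R))
        (d₁ : (Fin 5 → R) →ₗ[R] R),
        Function.Injective d₃ ∧ LinearMap.range d₃ = LinearMap.ker d₂ ∧
          LinearMap.range d₂ = LinearMap.ker d₁ ∧
          LinearMap.range d₁ = Ideal.span {Y * T, Y * Z, Y * W, F, G} := by
  have hY0 : Y ≠ 0 := hY.ne_zero
  -- Koszul exactness
  have K1 : ∀ a b c, a * T + b * Z + c * W = 0 →
      ∃ u v t, a = u * Z + v * W ∧ b = - u * T + t * W ∧ c = - v * T - t * Z := by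
    intro a b c h
    obtain ⟨c1, c2, rfl⟩ := hTZW a b c h
    have h1 : T ∣ Z * (b + c2 * W) := ⟨-a - c1 * W, by linear_combination h⟩
    obtain ⟨u, hu⟩ := hTZ _ h1
    refine ⟨-u, -c1, -c2, ?_, ?_, by ring⟩
    · apply mul_right_cancel₀ hT
      linear_combination h - Z * hu
    · linear_combination hu
  have K2 : ∀ u v t, u * Z + v * W = 0 → - u * T + t * W = 0 → - v * T - t * Z = 0 →
      ∃ s, u = s * W ∧ v = - s * Z ∧ t = s * T := by
    intro u v t h1 h2 h3
    obtain ⟨s, rfl⟩ := hTZ t ⟨-v, by linear_combination -h3⟩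
    refine ⟨s, ?_, ?_, by ring⟩
    · apply mul_right_cancel₀ hT
      linear_combination -h2
    · apply mul_right_cancel₀ hT
      linear_combination -h3
  let M1 : Matrix (Fin 1) (Fin 5) R := !![Y*T, Y*Z, Y*W, F, G]
  let M2 : Matrix (Fin 5) (Fin 6) R :=
    !![Z, W, 0, -F1, -G1, 0;
       -T, 0, W, -F2, -G2, 0;
       0, -T, -Z, -F3, -G3, 0;
       0, 0, 0, Y, 0, G;
       0, 0, 0, 0, Y, -F]
  let M3 : Matrix (Fin 6) (Fin 2) R :=
    !![W, G1*F2 - G2*F1;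
       -Z, G1*F3 - G3*F1;
       T, G2*F3 - G3*F2;
       0, -G;
       0, F;
       0, Y]
  have e1 : ∀ v, (LinearMap.proj 0 ∘ₗ M1.mulVecLin) v =
      Y*T*v 0 + Y*Z*v 1 + Y*W*v 2 + F*v 3 + G*v 4 := by
    intro v
    simp [M1, Matrix.mulVec, dotProduct, Fin.sum_univ_succ]
    ring
  have e2 : ∀ v, M2.mulVecLin v = ![Z*v 0 + W*v 1 - F1*v 3 - G1*v 4,
      -T*v 0 + W*v 2 - F2*v 3 - G2*v 4, -T*v 1 - Z*v 2 - F3*v 3 - G3*v 4,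
      Y*v 3 + G*v 5, Y*v 4 - F*v 5] := by
    intro v
    ext i; fin_cases i <;>
    simp [M2, Matrix.mulVec, dotProduct, Fin.sum_univ_succ] <;> ring
  have e3 : ∀ v, M3.mulVecLin v = ![W*v 0 + (G1*F2 - G2*F1)*v 1,
      -Z*v 0 + (G1*F3 - G3*F1)*v 1, T*v 0 + (G2*F3 - G3*F2)*v 1, -G*v 1, F*v 1, Y*v 1] := by
    intro v
    ext i; fin_cases i <;>
    simp [M3, Matrix.mulVec, dotProduct, Fin.sum_univ_succ]
  refine ⟨M3.mulVecLin, M2.mulVecLin, LinearMap.proj 0 ∘ₗ M1.mulVecLin, ?_, ?_, ?_, ?_⟩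
  · rw [← LinearMap.ker_eq_bot, LinearMap.ker_eq_bot']
    intro v hv
    rw [e3] at hv
    have h5 : Y * v 1 = 0 := congrFun hv 5
    have h2 : T * v 0 + (G2*F3 - G3*F2)*v 1 = 0 := congrFun hv 2
    have h1 : v 1 = 0 := by simpa [hY0] using h5
    have h0 : v 0 = 0 := by simpa [h1, hT] using h2
    ext i; fin_cases i <;> simp [h0, h1]
  · ext v
    rw [LinearMap.mem_range, LinearMap.mem_ker]
    constructor
    · rintro ⟨u, rfl⟩
      rw [e2, e3]
      ext i; fin_cases i <;> simp <;> subst hF hG <;> ring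
    · intro hv
      rw [e2] at hv
      have h0 : Z*v 0 + W*v 1 - F1*v 3 - G1*v 4 = 0 := congrFun hv 0
      have h1 : -T*v 0 + W*v 2 - F2*v 3 - G2*v 4 = 0 := congrFun hv 1
      have h2 : -T*v 1 - Z*v 2 - F3*v 3 - G3*v 4 = 0 := congrFun hv 2
      have h3 : Y*v 3 + G*v 5 = 0 := congrFun hv 3
      have h4 : Y*v 4 - F*v 5 = 0 := congrFun hv 4
      obtain ⟨q, hq⟩ : Y ∣ v 5 := (hY.dvd_or_dvd (show Y ∣ G * v 5 from
        ⟨-v 3, by linear_combination h3⟩)).resolve_left hYG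
      have h3' : v 3 = -G*q := by
        apply mul_left_cancel₀ hY0
        rw [hq] at h3; linear_combination h3
      have h4' : v 4 = F*q := by
        apply mul_left_cancel₀ hY0
        rw [hq] at h4; linear_combination h4
      rw [h3', h4'] at h0 h1 h2
      obtain ⟨s, s1, s2, s3⟩ := K2 (v 0 - (G1*F2 - G2*F1)*q) (v 1 - (G1*F3 - G3*F1)*q)
        (v 2 - (G2*F3 - G3*F2)*q)
        (by subst hF hG; linear_combination h0) (by subst hF hG; linear_combination h1)
        (by subst hF hG; linear_combination h2)
      refine ⟨![s, q], ?_⟩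
      rw [e3]
      ext i; fin_cases i <;> simp
      · linear_combination -s1
      · linear_combination -s2
      · linear_combination -s3
      · rw [h3']; ring
      · rw [h4']
      · rw [hq]
  · ext v
    rw [LinearMap.mem_range, LinearMap.mem_ker]
    constructor
    · rintro ⟨u, rfl⟩
      rw [e2, e1]
      simp
      subst hF hG
      ring
    · intro hv
      rw [e1] at hv
      obtain ⟨h, ⟨a, ha⟩, ⟨b, hb⟩⟩ := hFG (v 3) (v 4)
        ⟨-(T*v 0 + Z*v 1 + W*v 2), by linear_combination hv⟩
      have : (v 0 + a*F1 + b*G1) * T + (v 1 + a*F2 + b*G2) * Z + (v 2 + a*F3 + b*G3) * W = 0 := by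
        apply mul_left_cancel₀ hY0
        subst hF hG
        linear_combination hv - (F1*T + F2*Z + F3*W) * ha - (G1*T + G2*Z + G3*W) * hb
      obtain ⟨p, q, r, h1, h2, h3⟩ := K1 _ _ _ this
      refine ⟨![p, q, r, a, b, h], ?_⟩
      rw [e2]
      ext i; fin_cases i <;> simp
      · linear_combination -h1
      · linear_combination -h2
      · linear_combination -h3
      · linear_combination -ha
      · linear_combination -hb
  · apply le_antisymm
    · rintro _ ⟨v, rfl⟩
      rw [e1]
      refine add_mem (add_mem (add_mem (add_mem ?_ ?_) ?_) ?_) ?_ <;>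
      · apply Ideal.mul_mem_right
        apply Ideal.subset_span
        simp
    · rw [Ideal.span_le]
      rintro r (rfl | rfl | rfl | rfl | rfl)
      · exact ⟨![1,0,0,0,0], by rw [e1]; simp⟩
      · exact ⟨![0,1,0,0,0], by rw [e1]; simp⟩
      · exact ⟨![0,0,1,0,0], by rw [e1]; simp⟩
      · exact ⟨![0,0,0,1,0], by rw [e1]; simp⟩
      · exact ⟨![0,0,0,0,1], by rw [e1]; simp⟩

open RingTheory.Sequence in
theorem regA {R : Type*} [CommRing R] [IsDomain R] (Y T Q a : R)
    (hY : Prime Y) (hT : Prime T) (hYQ : ¬ Y ∣ Q) (hTQ : ¬ T ∣ Q)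
    (h1 : ∀ f v, Y ∣ a * f - Q * v → ∃ g, Y ∣ f - Q * g)
    (h2 : ∀ f v, T ∣ a * f - Q * v → ∃ g, T ∣ f - Q * g)
    (I : Ideal R) (hI : I ≠ ⊤) (i1 : Y * T ∈ I) (i2 : Q ∈ I) (i3 : a ∈ I) :
    IsRegular R [Y * T, Q, a] := by
  refine ⟨?_, ?_⟩
  · rw [isWeaklyRegular_iff]
    have e : ∀ l : List R, (Ideal.ofList l • (⊤ : Submodule R R)) = Ideal.ofList l := by
      intro l; simp
    intro i hi
    rw [isSMulRegular_quotient_iff_mem_of_smul_mem, e]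
    simp only [List.length_cons, List.length_nil] at hi
    interval_cases i
    · intro f hf
      simpa [Ideal.ofList, hY.ne_zero, hT.ne_zero] using hf
    · intro f hf
      simp [Ideal.ofList] at hf ⊢
      rw [Ideal.mem_span_singleton] at hf ⊢
      obtain ⟨c, hc⟩ := hf
      obtain ⟨f1, rfl⟩ := (hY.dvd_or_dvd (show Y ∣ Q * f from ⟨T*c, by rw [hc]; ring⟩)).resolve_left hYQ
      have : Q * f1 = T * c := by
        apply mul_left_cancel₀ hY.ne_zero; linear_combination hc
      obtain ⟨f2, rfl⟩ := (hT.dvd_or_dvd (show T ∣ Q * f1 from ⟨c, this⟩)).resolve_left hTQ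
      exact ⟨f2, by ring⟩
    · intro f hf
      simp [Ideal.ofList] at hf ⊢
      change a * f ∈ Ideal.span {Y * T, Q} at hf
      change f ∈ Ideal.span {Y * T, Q}
      rw [Ideal.mem_span_pair] at hf ⊢
      obtain ⟨u, v, huv⟩ := hf
      obtain ⟨g, f', hg⟩ := h1 f v ⟨T*u, by linear_combination -huv⟩
      obtain ⟨v', hv'⟩ := (hY.dvd_or_dvd (show Y ∣ Q * (v - a * g) from
        ⟨a*f' - T*u, by linear_combination huv + a * hg⟩)).resolve_left hYQ
      obtain ⟨g', f'', hg'⟩ := h2 f' v' ⟨u, by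
        apply mul_left_cancel₀ hY.ne_zero
        linear_combination -huv - a * hg + Q * hv'⟩
      exact ⟨f'', g + Y * g', by linear_combination -hg - Y*hg'⟩
  · intro h
    apply hI
    rw [eq_top_iff, h]
    simp only [smul_eq_mul, Ideal.mul_top, Ideal.ofList, Ideal.span_le]
    intro r hr
    simp at hr
    rcases hr with rfl | rfl | rfl <;> assumption

section pm
open MvPolynomial

set_option maxHeartbeats 2000000 in
theorem polyMain {k : Type*} [Field k] (c d b1 b2 p1 p2 p3 q1 q2 q3 : k)
    (hn : ¬ (q2 = 0 ∧ p2*p3 = p1*(d-c) ∧ p2*p2 = q3*p2 - q1*(d-c)))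
    (Y T Z W F G : MvPolynomial (Fin 4) k)
    (hYd : Y = X 1 - C c * X 0) (hTd : T = X 1 - C d * X 0) (hZd : Z = X 2 - C b1 * X 0)
    (hWd : W = X 3 - C b2 * X 0)
    (hF : F = (-(C p1 * X 0)) * T + (W - C p2 * X 0) * Z + (-(C p3 * X 0)) * W)
    (hG : G = (-(C q1 * X 0)) * T + (-(C q2 * X 0)) * Z + (W - C q3 * X 0) * W) :
    (∃ a₁ a₂ a₃ : MvPolynomial (Fin 4) k,
      a₁ ∈ Ideal.span {Y * T, Y * Z, Y * W, F, G} ∧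
      a₂ ∈ Ideal.span {Y * T, Y * Z, Y * W, F, G} ∧
      a₃ ∈ Ideal.span {Y * T, Y * Z, Y * W, F, G} ∧
      RingTheory.Sequence.IsRegular (MvPolynomial (Fin 4) k) [a₁, a₂, a₃]) ∧
    ∃ (d₃ : (Fin 2 → MvPolynomial (Fin 4) k) →ₗ[MvPolynomial (Fin 4) k]
          (Fin 6 → MvPolynomial (Fin 4) k))
        (d₂ : (Fin 6 → MvPolynomial (Fin 4) k) →ₗ[MvPolynomial (Fin 4) k]
          (Fin 5 → MvPolynomial (Fin 4) k))
        (d₁ : (Fin 5 → MvPolynomial (Fin 4) k) →ₗ[MvPolynomial (Fin 4) k]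
          MvPolynomial (Fin 4) k),
        Function.Injective d₃ ∧ LinearMap.range d₃ = LinearMap.ker d₂ ∧
          LinearMap.range d₂ = LinearMap.ker d₁ ∧
          LinearMap.range d₁ = Ideal.span {Y * T, Y * Z, Y * W, F, G} := by
  have hne : ∀ t : k, (X 1 - C t * X 0 : MvPolynomial (Fin 4) k) ≠ 0 := by
    intro t h
    have := congrArg (MvPolynomial.eval ![0, 1, 0, 0]) h
    simp at this
  obtain ⟨ψ, s, e1, hk, hC, h0, h1, h2, h3⟩ := psi_ex c b1 b2
  obtain ⟨ψ', s', e1', hk', hC', h0', h1', h2', h3'⟩ := psi_ex d b1 b2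
  rw [← hYd] at hk
  rw [← hTd] at hk'
  have pY : Prime Y := retr_prime (P := MvPolynomial (Fin 4) k) (S := Polynomial (Polynomial (Polynomial k))) ψ Y hk (by rw [hYd]; exact hne c)
  have pT : Prime T := retr_prime (P := MvPolynomial (Fin 4) k) (S := Polynomial (Polynomial (Polynomial k))) ψ' T hk' (by rw [hTd]; exact hne d)
  obtain ⟨Q, hQ⟩ : ∃ Q, Q = (W - C p2 * X 0) * G + C q2 * X 0 * F := ⟨_, rfl⟩
  obtain ⟨a, ha⟩ : ∃ a, a = F + Z * G + (Y * Z) * Z ^ 2 := ⟨_, rfl⟩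
  have vY : ψ Y = 0 := (hk Y).2 dvd_rfl
  have vT : ψ T = - Polynomial.C (Polynomial.C (Polynomial.C (d - c))) * Polynomial.C (Polynomial.C Polynomial.X) := by
    rw [hTd]; simp only [map_sub, map_mul, hC, h0, h1]; ring
  have vZ : ψ Z = Polynomial.X := by
    rw [hZd]; simp only [map_sub, map_mul, hC, h0, h2]; ring
  have vW : ψ W = Polynomial.C Polynomial.X := by
    rw [hWd]; simp only [map_sub, map_mul, hC, h0, h3]; ring
  have vT' : ψ' T = 0 := (hk' T).2 dvd_rfl
  have vY' : ψ' Y = Polynomial.C (Polynomial.C (Polynomial.C (d - c))) * Polynomial.C (Polynomial.C Polynomial.X) := by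
    rw [hYd]; simp only [map_sub, map_mul, hC', h0', h1']; ring
  have vZ' : ψ' Z = Polynomial.X := by
    rw [hZd]; simp only [map_sub, map_mul, hC', h0', h2']; ring
  have vW' : ψ' W = Polynomial.C Polynomial.X := by
    rw [hWd]; simp only [map_sub, map_mul, hC', h0', h3']; ring
  have vQ : ψ Q = Polynomial.C (cubR p2 p3 q2 q3 (p1*(d-c)) (q1*(d-c))) := by
    rw [hQ, hF, hG, cubR]
    simp only [map_sub, map_mul, map_add, map_neg, map_pow, hC, h0, vT, vZ, vW]; ring
  have vQ' : ψ' Q = Polynomial.C (cubR p2 p3 q2 q3 0 0) := by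
    rw [hQ, hF, hG, cubR]
    simp only [map_sub, map_mul, map_add, map_neg, map_pow, hC', h0', vT', vZ', vW', map_zero]; ring
  have rel : IsRelPrime (ψ a) (ψ Q) := by
    have := cop2 p2 p3 q2 q3 (p1*(d-c)) (q1*(d-c)) hn
    rw [vQ]
    convert this using 1
    rw [ha, hF, hG]
    simp only [map_sub, map_mul, map_add, map_neg, map_pow, hC, h0, vT, vZ, vW, vY]; ring
  have nQ : ¬ Y ∣ Q := by
    rw [← hk, vQ, Polynomial.C_eq_zero]
    exact cubR_ne _ _ _ _ _ _
  have nQ' : ¬ T ∣ Q := by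
    rw [← hk', vQ', Polynomial.C_eq_zero]
    exact cubR_ne _ _ _ _ _ _
  have r1 := retr_reg (P := MvPolynomial (Fin 4) k) (S := Polynomial (Polynomial (Polynomial k))) ψ s e1 Y hk a Q rel
  have r2 : ∀ f v, T ∣ a * f - Q * v → ∃ g, T ∣ f - Q * g := by
    by_cases hdc : d = c
    · have : T = Y := by rw [hTd, hYd, hdc]
      rw [this]; exact r1
    · have rel' : IsRelPrime (ψ' a) (ψ' Q) := by
        have := cop3 p2 p3 q2 q3 (d - c) (sub_ne_zero.2 hdc)
        rw [vQ']
        convert this using 1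
        rw [ha, hF, hG]
        simp only [map_sub, map_mul, map_add, map_neg, map_pow, hC', h0', vT', vZ', vW', vY']; ring
      exact retr_reg (P := MvPolynomial (Fin 4) k) (S := Polynomial (Polynomial (Polynomial k))) ψ' s' e1' T hk' a Q rel'
  have g1 : Y * T ∈ Ideal.span {Y * T, Y * Z, Y * W, F, G} := Ideal.subset_span (by simp)
  have g2 : Y * Z ∈ Ideal.span {Y * T, Y * Z, Y * W, F, G} := Ideal.subset_span (by simp)
  have g4 : F ∈ Ideal.span {Y * T, Y * Z, Y * W, F, G} := Ideal.subset_span (by simp)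
  have g5 : G ∈ Ideal.span {Y * T, Y * Z, Y * W, F, G} := Ideal.subset_span (by simp)
  have m2 : Q ∈ Ideal.span {Y * T, Y * Z, Y * W, F, G} := by
    rw [hQ]
    exact Ideal.add_mem _ (Ideal.mul_mem_left _ _ g5) (Ideal.mul_mem_left _ _ g4)
  have m3 : a ∈ Ideal.span {Y * T, Y * Z, Y * W, F, G} := by
    rw [ha]
    exact Ideal.add_mem _ (Ideal.add_mem _ g4 (Ideal.mul_mem_left _ _ g5))
      (Ideal.mul_mem_right _ _ g2)
  refine ⟨⟨Y * T, Q, a, g1, m2, m3, ?_⟩, ?_⟩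
  · refine regA Y T Q a pY pT nQ nQ' r1 r2
      (RingHom.ker (MvPolynomial.constantCoeff (σ := Fin 4) (R := k))) (RingHom.ker_ne_top _) ?_ ?_ ?_
    all_goals
      rw [RingHom.mem_ker]
      simp [hQ, ha, hF, hG, hYd, hTd, hZd, hWd]
  · have vG : ψ G ≠ 0 := by
      have := G_ne (d - c) q1 q2 q3
      convert this using 1
      rw [hG]
      rw [map_add, map_add, map_mul, map_mul, map_mul, map_sub, map_neg, map_neg, map_mul, map_mul,
        map_mul, hC, hC, hC, h0, vT, vZ, vW]
    have rel2 : IsRelPrime (ψ F) (ψ G) :=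
      retr_rel (P := MvPolynomial (Fin 4) k) (S := Polynomial (Polynomial (Polynomial k)))
        ψ Y Z F G _ _ a Q vY ha hQ rel
    refine resA Y T Z W F G _ _ _ _ _ _ hF hG pT.ne_zero pY ?_ ?_ ?_ ?_
    · intro a h
      rw [← hk', map_mul, vZ', mul_eq_zero] at h
      exact (hk' a).1 (h.resolve_left Polynomial.X_ne_zero)
    · refine retr_kos (P := MvPolynomial (Fin 4) k) (S := Polynomial (Polynomial (Polynomial k)))
        ψ' s' e1' T Z W hk' ?_ ?_
      · rw [vZ']; exact Polynomial.prime_X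
      · rw [vZ', vW', Polynomial.X_dvd_iff, Polynomial.coeff_C_zero]
        exact Polynomial.X_ne_zero
    · rw [← hk]; exact vG
    · exact retr_syz (P := MvPolynomial (Fin 4) k) (S := Polynomial (Polynomial (Polynomial k))) ψ s e1 Y hk F G vG rel2

end pm

open MvPolynomial

noncomputable section

theorem lin_ex {k : Type*} [Field k] (f : MvPolynomial (Fin 4) k)
    (hf : f ∈ homogeneousSubmodule (Fin 4) k 1) :
    ∃ a b c d : k, f = a • X 0 + b • X 1 + c • X 2 + d • X 3 := by
  refine ⟨coeff (Finsupp.single 0 1) f, coeff (Finsupp.single 1 1) f,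
    coeff (Finsupp.single 2 1) f, coeff (Finsupp.single 3 1) f, ?_⟩
  rw [mem_homogeneousSubmodule] at hf
  have hg : (coeff (Finsupp.single 0 1) f • X 0 + coeff (Finsupp.single 1 1) f • X 1 +
    coeff (Finsupp.single 2 1) f • X 2 + coeff (Finsupp.single 3 1) f • X 3 : MvPolynomial (Fin 4) k).IsHomogeneous 1 := by
    rw [← mem_homogeneousSubmodule]
    refine add_mem (add_mem (add_mem ?_ ?_) ?_) ?_ <;>
    exact Submodule.smul_mem _ _ (isHomogeneous_X k _)
  ext m
  by_cases hm : m.degree = 1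
  · obtain ⟨i, rfl⟩ : ∃ i, m = Finsupp.single i 1 := (Finsupp.sum_eq_one_iff m).1 hm
    fin_cases i <;> simp [coeff_X, Finsupp.single_left_inj]
  · rw [hf.coeff_eq_zero hm, hg.coeff_eq_zero hm]

theorem lin_un {k : Type*} [Field k] (a b c d : k)
    (h : (a • X 0 + b • X 1 + c • X 2 + d • X 3 : MvPolynomial (Fin 4) k) = 0) :
    a = 0 ∧ b = 0 ∧ c = 0 ∧ d = 0 := by
  have h0 := congrArg (MvPolynomial.eval ![1, 0, 0, 0]) h
  have h1 := congrArg (MvPolynomial.eval ![0, 1, 0, 0]) h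
  have h2 := congrArg (MvPolynomial.eval ![0, 0, 1, 0]) h
  have h3 := congrArg (MvPolynomial.eval ![0, 0, 0, 1]) h
  simp [smul_eval] at h0 h1 h2 h3
  exact ⟨h0, h1, h2, h3⟩

def triMap {k : Type*} [Field k] (Φ : MvPolynomial (Fin 4) k →ₗ[k] k) :
    homogeneousSubmodule (Fin 4) k 1 →ₗ[k] homogeneousSubmodule (Fin 4) k 1 →ₗ[k]
      (homogeneousSubmodule (Fin 4) k 1 →ₗ[k] k) :=
  LinearMap.mk₂ k (fun u v =>
    Φ ∘ₗ LinearMap.mulLeft k (u.1 * v.1) ∘ₗ (homogeneousSubmodule (Fin 4) k 1).subtype)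
    (by intros; ext; simp [add_mul, mul_assoc]) (by intros; ext; simp [mul_assoc])
    (by intros; ext; simp [add_mul, mul_add, mul_assoc]) (by intros; ext; simp [mul_assoc])

theorem triMap_apply {k : Type*} [Field k] (Φ : MvPolynomial (Fin 4) k →ₗ[k] k)
    (u v t : homogeneousSubmodule (Fin 4) k 1) : triMap Φ u v t = Φ (u.1 * v.1 * t.1) := rfl

theorem pMap_app {k : Type*} [Field k] (Φ : MvPolynomial (Fin 4) k →ₗ[k] k)
    (u v : homogeneousSubmodule (Fin 4) k 1) : pMap k Φ u v = Φ (X 0 * u.1 * v.1) := rfl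

variable (k : Type*) [Field k]

/-- **Proposition 13.10.**  Assume `Φ` is a degree-3 Macaulay inverse system on
`P = k[x,y,z,w]` whose annihilator contains no nonzero linear form, `p` is
bijective, and `SM = diag(α,0,0)` with `α ≠ 0`.  Then the ideal `J` generated
by the five quadrics `y² − x·ℓ_{y²}`, `yz − x·ℓ_{yz}`, `yw − x·ℓ_{yw}`,
`zw − x·ℓ_{zw}`, `w² − x·ℓ_{w²}` is a perfect ideal of grade three:  it
contains a length-three regular sequence and `P/J` has a free resolution
`0 → P² → P⁶ → P⁵ → P`. -/
theorem span_five_quadrics_perfect_grade_three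
    (Φ : MvPolynomial (Fin 4) k →ₗ[k] k)
    (hΦ : ∀ m : Fin 4 →₀ ℕ, (m.sum fun _ e => e) ≠ 3 → Φ (monomial m 1) = 0)
    (hlin : ∀ u ∈ homogeneousSubmodule (Fin 4) k 1, u ∈ annIdeal k Φ → u = 0)
    (hp : Function.Bijective (pMap k Φ))
    (ly2 lyz lyw lz2 lzw lw2 : MvPolynomial (Fin 4) k)
    (hly2m : ly2 ∈ homogeneousSubmodule (Fin 4) k 1)
    (hlyzm : lyz ∈ homogeneousSubmodule (Fin 4) k 1)
    (hlywm : lyw ∈ homogeneousSubmodule (Fin 4) k 1)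
    (hlz2m : lz2 ∈ homogeneousSubmodule (Fin 4) k 1)
    (hlzwm : lzw ∈ homogeneousSubmodule (Fin 4) k 1)
    (hlw2m : lw2 ∈ homogeneousSubmodule (Fin 4) k 1)
    (hly2 : ∀ v ∈ homogeneousSubmodule (Fin 4) k 1,
      Φ (X 0 * ly2 * v) = Φ (X 1 ^ 2 * v))
    (hlyz : ∀ v ∈ homogeneousSubmodule (Fin 4) k 1,
      Φ (X 0 * lyz * v) = Φ (X 1 * X 2 * v))
    (hlyw : ∀ v ∈ homogeneousSubmodule (Fin 4) k 1,
      Φ (X 0 * lyw * v) = Φ (X 1 * X 3 * v))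
    (hlz2 : ∀ v ∈ homogeneousSubmodule (Fin 4) k 1,
      Φ (X 0 * lz2 * v) = Φ (X 2 ^ 2 * v))
    (hlzw : ∀ v ∈ homogeneousSubmodule (Fin 4) k 1,
      Φ (X 0 * lzw * v) = Φ (X 2 * X 3 * v))
    (hlw2 : ∀ v ∈ homogeneousSubmodule (Fin 4) k 1,
      Φ (X 0 * lw2 * v) = Φ (X 3 ^ 2 * v))
    (α : k) (hα : α ≠ 0)
    (hSM : smMatrix k Φ ly2 lyz lyw lz2 lzw lw2 = !![α, 0, 0; 0, 0, 0; 0, 0, 0]) :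
    (∃ a₁ a₂ a₃ : MvPolynomial (Fin 4) k,
        a₁ ∈ Ideal.span {X 1 ^ 2 - X 0 * ly2, X 1 * X 2 - X 0 * lyz,
            X 1 * X 3 - X 0 * lyw, X 2 * X 3 - X 0 * lzw, X 3 ^ 2 - X 0 * lw2} ∧
          a₂ ∈ Ideal.span {X 1 ^ 2 - X 0 * ly2, X 1 * X 2 - X 0 * lyz,
            X 1 * X 3 - X 0 * lyw, X 2 * X 3 - X 0 * lzw, X 3 ^ 2 - X 0 * lw2} ∧
          a₃ ∈ Ideal.span {X 1 ^ 2 - X 0 * ly2, X 1 * X 2 - X 0 * lyz,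
            X 1 * X 3 - X 0 * lyw, X 2 * X 3 - X 0 * lzw, X 3 ^ 2 - X 0 * lw2} ∧
          RingTheory.Sequence.IsRegular (MvPolynomial (Fin 4) k) [a₁, a₂, a₃]) ∧
      ∃ (d₃ : (Fin 2 → MvPolynomial (Fin 4) k) →ₗ[MvPolynomial (Fin 4) k]
          (Fin 6 → MvPolynomial (Fin 4) k))
        (d₂ : (Fin 6 → MvPolynomial (Fin 4) k) →ₗ[MvPolynomial (Fin 4) k]
          (Fin 5 → MvPolynomial (Fin 4) k))
        (d₁ : (Fin 5 → MvPolynomial (Fin 4) k) →ₗ[MvPolynomial (Fin 4) k]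
          MvPolynomial (Fin 4) k),
        Function.Injective d₃ ∧ LinearMap.range d₃ = LinearMap.ker d₂ ∧
          LinearMap.range d₂ = LinearMap.ker d₁ ∧
          LinearMap.range d₁ =
            Ideal.span {X 1 ^ 2 - X 0 * ly2, X 1 * X 2 - X 0 * lyz,
              X 1 * X 3 - X 0 * lyw, X 2 * X 3 - X 0 * lzw, X 3 ^ 2 - X 0 * lw2} := by
  have hx0 : (X 0 : MvPolynomial (Fin 4) k) ∈ homogeneousSubmodule (Fin 4) k 1 := isHomogeneous_X k _
  have hy0 : (X 1 : MvPolynomial (Fin 4) k) ∈ homogeneousSubmodule (Fin 4) k 1 := isHomogeneous_X k _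
  have hz0 : (X 2 : MvPolynomial (Fin 4) k) ∈ homogeneousSubmodule (Fin 4) k 1 := isHomogeneous_X k _
  have hw0 : (X 3 : MvPolynomial (Fin 4) k) ∈ homogeneousSubmodule (Fin 4) k 1 := isHomogeneous_X k _
  obtain ⟨m, hm⟩ : ∃ m : homogeneousSubmodule (Fin 4) k 1 →ₗ[k] homogeneousSubmodule (Fin 4) k 1 →ₗ[k]
      homogeneousSubmodule (Fin 4) k 1,
      ∀ u v t : homogeneousSubmodule (Fin 4) k 1, pMap k Φ (m u v) t = Φ (u.1 * v.1 * t.1) := by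
    refine ⟨(triMap Φ).compr₂ (LinearEquiv.ofBijective (pMap k Φ) hp).symm.toLinearMap, ?_⟩
    intro u v t
    have := (LinearEquiv.ofBijective (pMap k Φ) hp).apply_symm_apply (triMap Φ u v)
    exact congrArg (fun g : _ →ₗ[k] _ => g t) this
  have hinj : ∀ u u' : homogeneousSubmodule (Fin 4) k 1,
      (∀ t, pMap k Φ u t = pMap k Φ u' t) → u = u' := fun u u' h => hp.1 (LinearMap.ext h)
  have my2 : m ⟨X 1, hy0⟩ ⟨X 1, hy0⟩ = ⟨ly2, hly2m⟩ := by
    apply hinj; intro t; rw [hm, pMap_app, hly2 _ t.2, sq]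
  have myz : m ⟨X 1, hy0⟩ ⟨X 2, hz0⟩ = ⟨lyz, hlyzm⟩ := by
    apply hinj; intro t; rw [hm, pMap_app, hlyz _ t.2]
  have myw : m ⟨X 1, hy0⟩ ⟨X 3, hw0⟩ = ⟨lyw, hlywm⟩ := by
    apply hinj; intro t; rw [hm, pMap_app, hlyw _ t.2]
  have mz2 : m ⟨X 2, hz0⟩ ⟨X 2, hz0⟩ = ⟨lz2, hlz2m⟩ := by
    apply hinj; intro t; rw [hm, pMap_app, hlz2 _ t.2, sq]
  have mzw : m ⟨X 2, hz0⟩ ⟨X 3, hw0⟩ = ⟨lzw, hlzwm⟩ := by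
    apply hinj; intro t; rw [hm, pMap_app, hlzw _ t.2]
  have mw2 : m ⟨X 3, hw0⟩ ⟨X 3, hw0⟩ = ⟨lw2, hlw2m⟩ := by
    apply hinj; intro t; rw [hm, pMap_app, hlw2 _ t.2, sq]
  have e00 := congrFun (congrFun hSM 0) 0
  have e01 := congrFun (congrFun hSM 0) 1
  have e02 := congrFun (congrFun hSM 0) 2
  have e11 := congrFun (congrFun hSM 1) 1
  have e12 := congrFun (congrFun hSM 1) 2
  have e22 := congrFun (congrFun hSM 2) 2
  simp [smMatrix] at e00 e01 e02 e11 e12 e22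
  have key := algV m (pMap k Φ) ⟨X 0, hx0⟩ ⟨X 1, hy0⟩ ⟨X 2, hz0⟩ ⟨X 3, hw0⟩
    (by intro u v; apply hinj; intro t; rw [hm, hm, mul_comm u.1])
    (by intro u v t; rw [hm, hm]; congr 1; ring)
    (by intro v; apply hinj; intro t; rw [hm, pMap_app])
    (by intro u h; apply hinj; intro t; rw [h t, map_zero]; rfl)
    (by
      intro v
      obtain ⟨a, b, c, d, h⟩ := lin_ex v.1 v.2
      exact ⟨a, b, c, d, Subtype.ext h⟩)
    (by
      intro a b c d h
      exact lin_un a b c d (congrArg Subtype.val h))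
    α hα
    (by rw [mz2, mw2, mzw, pMap_app, pMap_app, hlz2 _ hlw2m, hlzw _ hlzwm]; exact e00)
    (by
      rw [mzw, myw, myz, mw2, pMap_app, pMap_app, hlzw _ hlywm, hlyz _ hlw2m]
      rw [mul_comm (X 2) (X 1)] at e01
      exact sub_eq_zero.1 e01)
    (by
      rw [mzw, myw, myz, mz2, pMap_app, pMap_app, hlyz _ hlzwm, hlz2 _ hlywm]
      exact sub_eq_zero.1 e02)
    (by
      rw [my2, myw, mw2, pMap_app, pMap_app, hly2 _ hlw2m, hlyw _ hlywm]
      exact sub_eq_zero.1 e11)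
    (by
      rw [myz, myw, my2, mzw, pMap_app, pMap_app, hlyz _ hlywm, hly2 _ hlzwm]
      exact sub_eq_zero.1 e12)
    (by
      rw [my2, mz2, myz, pMap_app, pMap_app, hly2 _ hlz2m, hlyz _ hlyzm]
      exact sub_eq_zero.1 e22)
  obtain ⟨c, d, b1, b2, p1, p2, p3, q1, q2, q3, k1, k2, k3, k4, k5, hn⟩ := key
  rw [my2] at k1
  rw [myz] at k2
  rw [myw] at k3
  rw [mzw] at k4
  rw [mw2] at k5
  have k1' := congrArg Subtype.val k1
  have k2' := congrArg Subtype.val k2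
  have k3' := congrArg Subtype.val k3
  have k4' := congrArg Subtype.val k4
  have k5' := congrArg Subtype.val k5
  simp only [Submodule.coe_add, Submodule.coe_sub, Submodule.coe_smul, smul_eq_C_mul, map_add,
    map_mul] at k1' k2' k3' k4' k5'
  have C2 : (C (2 : k) : MvPolynomial (Fin 4) k) = 2 := map_ofNat C 2
  have main := polyMain c d b1 b2 p1 p2 p3 q1 q2 q3 hn _ _ _ _ _ _ rfl rfl rfl rfl rfl rfl
  have f1 : X 1 ^ 2 - X 0 * ly2 = (X 1 - C c * X 0) * (X 1 - C d * X 0) := by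
    rw [k1']; ring
  have f2 : X 1 * X 2 - X 0 * lyz = (X 1 - C c * X 0) * (X 2 - C b1 * X 0) := by
    rw [k2']; ring
  have f3 : X 1 * X 3 - X 0 * lyw = (X 1 - C c * X 0) * (X 3 - C b2 * X 0) := by
    rw [k3']; ring
  have f4 : X 2 * X 3 - X 0 * lzw = (-(C p1 * X 0)) * (X 1 - C d * X 0) +
      ((X 3 - C b2 * X 0) - C p2 * X 0) * (X 2 - C b1 * X 0) +
      (-(C p3 * X 0)) * (X 3 - C b2 * X 0) := by
    rw [k4']; ring
  have f5 : X 3 ^ 2 - X 0 * lw2 = (-(C q1 * X 0)) * (X 1 - C d * X 0) +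
      (-(C q2 * X 0)) * (X 2 - C b1 * X 0) +
      ((X 3 - C b2 * X 0) - C q3 * X 0) * (X 3 - C b2 * X 0) := by
    rw [k5', C2]; ring
  rw [f1, f2, f3, f4, f5]
  exact main

end
end
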